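/- arXiv:2303.11487 — 5 statements merged into one kernel-verified Lean document; each statement's English description precedes it below -/
import Mathlib

section
/- The pseudo-metrics Ē and Ẽ are uniformly equivalent on X: the identity maps (X,Ē) → (X,Ẽ) and (X,Ẽ) → (X,Ē) are both uniformly continuous. -/
open Filter MeasureTheory Topology

noncomputable def EnDist {X : Type*} [MetricSpace X] (T : X → X) (n : ℕ) (x y : X) : ℝ :=
  ⨅ σ : Equiv.Perm (Fin n), (1 / (n : ℝ)) * ∑ k : Fin n, dist (T^[(k : ℕ)] x) (T^[((σ k) : ℕ)] y)

noncomputable def Ebar {X : Type*} [MetricSpace X] (T : X → X) (x y : X) : ℝ :=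
  Filter.limsup (fun n => EnDist T n x y) Filter.atTop

/-- `limsup_n (1/n) min_{σ∈S_n} |{0 ≤ j < n : d(T^j x, T^{σ(j)} y) > ε}|`. -/
noncomputable def DeltaBar {X : Type*} [MetricSpace X] (T : X → X) (x y : X) (ε : ℝ) : ℝ :=
  Filter.limsup (fun n : ℕ => (1 / (n : ℝ)) *
    ⨅ σ : Equiv.Perm (Fin n),
      ((Finset.univ.filter fun j : Fin n =>
        ε < dist (T^[(j : ℕ)] x) (T^[((σ j) : ℕ)] y)).card : ℝ)) Filter.atTop

/-- `Ẽ(x,y) = inf{ε > 0 : limsup_n (1/n) min_{σ∈S_n} Δ_σ(x,y,ε) < ε}`. -/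
noncomputable def Etilde {X : Type*} [MetricSpace X] (T : X → X) (x y : X) : ℝ :=
  sInf {ε : ℝ | 0 < ε ∧ DeltaBar T x y ε < ε}

/-- The normalized minimal count. -/
noncomputable def DnAux {X : Type*} [MetricSpace X] (T : X → X) (x y : X) (ε : ℝ) (n : ℕ) : ℝ :=
  (1 / (n : ℝ)) *
    ⨅ σ : Equiv.Perm (Fin n),
      ((Finset.univ.filter fun j : Fin n =>
        ε < dist (T^[(j : ℕ)] x) (T^[((σ j) : ℕ)] y)).card : ℝ)

lemma DnAux_nonneg {X : Type*} [MetricSpace X] (T : X → X) (x y : X) (ε : ℝ) (n : ℕ) :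
    0 ≤ DnAux T x y ε n :=
  mul_nonneg (by positivity) (Real.iInf_nonneg fun _ => by positivity)

lemma EnDist_nonneg_aux {X : Type*} [MetricSpace X] (T : X → X) (x y : X) (n : ℕ) :
    0 ≤ EnDist T n x y :=
  Real.iInf_nonneg fun _ => by positivity

lemma mul_DnAux_le {X : Type*} [MetricSpace X] (T : X → X) (x y : X) (e : ℝ) (he : 0 < e) (n : ℕ) :
    e * DnAux T x y e n ≤ EnDist T n x y := by
  unfold EnDist DnAux
  refine le_ciInf fun σ => ?_
  have h1 : (⨅ σ : Equiv.Perm (Fin n), ((Finset.univ.filter fun j : Fin n =>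
        e < dist (T^[(j : ℕ)] x) (T^[((σ j) : ℕ)] y)).card : ℝ)) ≤
      ((Finset.univ.filter fun j : Fin n =>
        e < dist (T^[(j : ℕ)] x) (T^[((σ j) : ℕ)] y)).card : ℝ) :=
    ciInf_le (Set.finite_range _).bddBelow σ
  have h2 : e * ((Finset.univ.filter fun j : Fin n =>
        e < dist (T^[(j : ℕ)] x) (T^[((σ j) : ℕ)] y)).card : ℝ) ≤
      ∑ k : Fin n, dist (T^[(k : ℕ)] x) (T^[((σ k) : ℕ)] y) := by
    rw [Finset.card_filter]
    push_cast
    rw [Finset.mul_sum]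
    refine Finset.sum_le_sum fun k _ => ?_
    split_ifs with h
    · linarith
    · simp
  rw [mul_left_comm]
  exact mul_le_mul_of_nonneg_left ((mul_le_mul_of_nonneg_left h1 he.le).trans h2) (by positivity)

lemma EnDist_le_DnAux {X : Type*} [MetricSpace X] (hd : ∀ a b : X, dist a b ≤ 1)
    (T : X → X) (x y : X) (e : ℝ) (he : 0 ≤ e) (n : ℕ) :
    EnDist T n x y ≤ DnAux T x y e n + e := by
  obtain ⟨σ, hσ⟩ := exists_eq_ciInf_of_finite (f := fun σ : Equiv.Perm (Fin n) =>
    ((Finset.univ.filter fun j : Fin n =>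
        e < dist (T^[(j : ℕ)] x) (T^[((σ j) : ℕ)] y)).card : ℝ))
  unfold EnDist DnAux
  rw [← hσ]
  refine (ciInf_le (Set.finite_range _).bddBelow σ).trans ?_
  have h2 : ∑ k : Fin n, dist (T^[(k : ℕ)] x) (T^[((σ k) : ℕ)] y) ≤
      ((Finset.univ.filter fun j : Fin n =>
        e < dist (T^[(j : ℕ)] x) (T^[((σ j) : ℕ)] y)).card : ℝ) + n * e := by
    have h3 : (n : ℝ) * e = ∑ _k : Fin n, e := by simp
    rw [Finset.card_filter, h3]
    push_cast
    rw [← Finset.sum_add_distrib]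
    refine Finset.sum_le_sum fun k _ => ?_
    split_ifs with h
    · linarith [hd (T^[(k : ℕ)] x) (T^[((σ k) : ℕ)] y)]
    · linarith
  refine (mul_le_mul_of_nonneg_left h2 (by positivity)).trans ?_
  rw [mul_add]
  rcases Nat.eq_zero_or_pos n with h | h
  · subst h; simpa using he
  · have : (n : ℝ) ≠ 0 := by positivity
    rw [← mul_assoc, one_div, inv_mul_cancel₀ this, one_mul]

lemma DnAux_le_one {X : Type*} [MetricSpace X] (T : X → X) (x y : X) (e : ℝ) (n : ℕ) :
    DnAux T x y e n ≤ 1 := by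
  unfold DnAux
  rcases Nat.eq_zero_or_pos n with h | h
  · subst h; simp
  · have hn : (0 : ℝ) < n := by positivity
    rw [one_div, inv_mul_le_iff₀ hn, mul_one]
    refine (ciInf_le (Set.finite_range _).bddBelow (1 : Equiv.Perm (Fin n))).trans ?_
    exact_mod_cast (Finset.card_le_univ _).trans (by simp)

lemma DnAux_eq_zero {X : Type*} [MetricSpace X] (hd : ∀ a b : X, dist a b ≤ 1)
    (T : X → X) (x y : X) (n : ℕ) : DnAux T x y 2 n = 0 := by
  unfold DnAux
  have : ∀ a b : X, ¬ (2 < dist a b) := fun a b => by linarith [hd a b]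
  simp [this]

lemma DeltaBar_eq_aux {X : Type*} [MetricSpace X] (T : X → X) (x y : X) (e : ℝ) :
    DeltaBar T x y e = limsup (DnAux T x y e) atTop := rfl

/-- assuming `diam X = 1`, the pseudo-metrics `Ē` and `Ẽ` are uniformly
equivalent: both identity maps `(X,Ē) → (X,Ẽ)` and `(X,Ẽ) → (X,Ē)` are uniformly continuous. -/
theorem Ebar_Etilde_uniformly_equivalent {X : Type*} [MetricSpace X] [CompactSpace X]
    (hdiam : Metric.diam (Set.univ : Set X) = 1) (T : X → X) (hT : Continuous T) :
    (∀ ε > (0 : ℝ), ∃ δ > (0 : ℝ), ∀ x y : X, Ebar T x y < δ → Etilde T x y < ε) ∧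
    (∀ ε > (0 : ℝ), ∃ δ > (0 : ℝ), ∀ x y : X, Etilde T x y < δ → Ebar T x y < ε) := by
  have hd : ∀ a b : X, dist a b ≤ 1 := fun a b => by
    rw [← hdiam]
    exact Metric.dist_le_diam_of_mem isCompact_univ.isBounded (Set.mem_univ _) (Set.mem_univ _)
  have hbE : ∀ x y : X, IsBoundedUnder (· ≤ ·) atTop (fun n => EnDist T n x y) := fun x y =>
    isBoundedUnder_of ⟨1 + 0, fun n => (EnDist_le_DnAux hd T x y 0 le_rfl n).trans
      (by linarith [DnAux_le_one T x y 0 n])⟩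
  have hbD : ∀ (x y : X) (e : ℝ), IsBoundedUnder (· ≤ ·) atTop (DnAux T x y e) := fun x y e =>
    isBoundedUnder_of ⟨1, fun n => DnAux_le_one T x y e n⟩
  have hcE : ∀ x y : X, IsCoboundedUnder (· ≤ ·) atTop (fun n => EnDist T n x y) := fun x y =>
    IsBoundedUnder.isCoboundedUnder_le
      (isBoundedUnder_of ⟨0, fun n => EnDist_nonneg_aux T x y n⟩)
  have hcD : ∀ (x y : X) (e : ℝ), IsCoboundedUnder (· ≤ ·) atTop (DnAux T x y e) := fun x y e =>
    IsBoundedUnder.isCoboundedUnder_le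
      (isBoundedUnder_of ⟨0, fun n => DnAux_nonneg T x y e n⟩)
  constructor
  · intro ε hε
    refine ⟨(ε / 2) * (ε / 4), by positivity, fun x y h => ?_⟩
    have hev := eventually_lt_of_limsup_lt h (hbE x y)
    have hle : DeltaBar T x y (ε / 2) ≤ ε / 4 := by
      rw [DeltaBar_eq_aux]
      refine limsup_le_of_le (hcD x y _) ?_
      filter_upwards [hev] with n hn
      have h1 := (mul_DnAux_le T x y (ε / 2) (by positivity) n).trans hn.le
      exact le_of_mul_le_mul_left h1 (by positivity)
    have : Etilde T x y ≤ ε / 2 :=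
      csInf_le ⟨0, fun e he => he.1.le⟩ ⟨by positivity, by linarith⟩
    linarith
  · intro ε hε
    refine ⟨ε / 4, by positivity, fun x y h => ?_⟩
    have hne : {ε : ℝ | 0 < ε ∧ DeltaBar T x y ε < ε}.Nonempty := by
      refine ⟨2, by norm_num, ?_⟩
      have h0 : DnAux T x y 2 = fun _ => 0 := funext fun n => DnAux_eq_zero hd T x y n
      rw [DeltaBar_eq_aux, h0, limsup_const]
      norm_num
    obtain ⟨e, ⟨he0, he⟩, hlt⟩ := exists_lt_of_csInf_lt hne h
    rw [DeltaBar_eq_aux] at he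
    have hev := eventually_lt_of_limsup_lt he (hbD x y e)
    have hle : Ebar T x y ≤ 2 * e := by
      refine limsup_le_of_le (hcE x y) ?_
      filter_upwards [hev] with n hn
      linarith [EnDist_le_DnAux hd T x y e he0.le n]
    linarith
end

section
/- If x ∈ X is a generic point, then for every y ∈ X, ω̂_T(x) = ω̂_T(y) if and only if Ē(x,y) = 0. -/
open Filter MeasureTheory Topology
open scoped ENNReal NNReal

/-- The empirical measure `m_T(x,n) = (1/n) Σ_{j<n} δ_{T^j x}`. -/
noncomputable def empMeas {X : Type*} [MeasurableSpace X] (T : X → X) (x : X) (n : ℕ) :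
    Measure X :=
  ((n : ℝ≥0∞))⁻¹ • ∑ j ∈ Finset.range n, MeasureTheory.Measure.dirac (T^[j] x)

/-- The empirical measure `m_T(x,n+1)` as a probability measure; the sequence
`n ↦ empProb T x n` is the sequence of empirical measures of `x`. -/
noncomputable def empProb {X : Type*} [MeasurableSpace X] (T : X → X) (x : X) (n : ℕ) :
    ProbabilityMeasure X :=
  ⟨empMeas T x (n + 1), by
    constructor
    rw [empMeas, Measure.smul_apply, Measure.finset_sum_apply]
    simp only [measure_univ, Finset.sum_const, Finset.card_range, nsmul_eq_mul, mul_one,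
      smul_eq_mul]
    rw [ENNReal.inv_mul_cancel (by exact_mod_cast Nat.succ_ne_zero n) (by simp)]⟩

/-- `ω̂_T(x)`: the set of measures quasi-generated by `x`, i.e. the weak* limit points of
the sequence of empirical measures of `x`. -/
noncomputable def omegaHat {X : Type*} [MetricSpace X] [MeasurableSpace X]
    [OpensMeasurableSpace X] (T : X → X) (x : X) : Set (ProbabilityMeasure X) :=
  {μ | MapClusterPt μ Filter.atTop (empProb T x)}

/-- The Prokhorov metric on probability measures. -/
noncomputable def rhoP {X : Type*} [MetricSpace X] [MeasurableSpace X]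
    (μ ν : ProbabilityMeasure X) : ℝ :=
  levyProkhorovDist μ.toMeasure ν.toMeasure

/-- The Hausdorff distance induced by the Prokhorov metric. -/
noncomputable def rhoH {X : Type*} [MetricSpace X] [MeasurableSpace X]
    (A B : Set (ProbabilityMeasure X)) : ℝ :=
  max (⨆ μ ∈ A, ⨅ ν ∈ B, rhoP μ ν) (⨆ ν ∈ B, ⨅ μ ∈ A, rhoP μ ν)

lemma exists_perm_match {n : ℕ} {ι : Type*} [Fintype ι] [DecidableEq ι] (f g : Fin n → ι) :
    ∃ σ : Equiv.Perm (Fin n),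
      ((Finset.univ.filter (fun k => f k ≠ g (σ k))).card : ℝ) ≤
        ∑ i, |((Finset.univ.filter (fun k => f k = i)).card : ℝ) -
          ((Finset.univ.filter (fun k => g k = i)).card : ℝ)| := by
  obtain ⟨σ, hσ⟩ := Finite.exists_min
    (fun σ : Equiv.Perm (Fin n) => (Finset.univ.filter (fun k => f k ≠ g (σ k))).card)
  refine ⟨σ, ?_⟩
  have key : ∀ k l, f k ≠ g (σ k) → f l ≠ g (σ l) → f k = g (σ l) → False := by
    intro k l hk hl hkl
    have h := hσ ((Equiv.swap k l).trans σ)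
    refine absurd h (not_le.mpr (Finset.card_lt_card ?_))
    rw [Finset.ssubset_iff_of_subset]
    · refine ⟨k, by simpa using hk, fun hmem => (Finset.mem_filter.mp hmem).2 (by simpa using hkl)⟩
    · intro j hj
      replace hj : f j ≠ g (σ (Equiv.swap k l j)) := (Finset.mem_filter.mp hj).2
      refine Finset.mem_filter.mpr ⟨Finset.mem_univ _, ?_⟩
      by_cases h1 : j = k
      · subst h1; exact hk
      by_cases h2 : j = l
      · subst h2; exact hl
      rwa [Equiv.swap_apply_of_ne_of_ne h1 h2] at hj
  rw [Finset.card_eq_sum_card_fiberwise (f := f) (t := Finset.univ) (by simp)]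
  push_cast
  refine Finset.sum_le_sum fun i _ => ?_
  have e1 : (Finset.univ.filter (fun k => g k = i)).card
      = (Finset.univ.filter (fun k => g (σ k) = i)).card := by
    symm
    refine Finset.card_bij (fun k _ => σ k) (by simp) (by simp) ?_
    intro b hb
    exact ⟨σ.symm b, by simpa using hb, by simp⟩
  rw [e1]
  have e2 := Finset.card_filter_add_card_filter_not (s := Finset.univ.filter (fun k => f k = i))
    (fun k => f k ≠ g (σ k))
  have e3 := Finset.card_filter_add_card_filter_not
    (s := Finset.univ.filter (fun k => g (σ k) = i)) (fun k => f k ≠ g (σ k))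
  have e4 : (Finset.univ.filter (fun k => f k = i)).filter (fun k => ¬ f k ≠ g (σ k))
      = (Finset.univ.filter (fun k => g (σ k) = i)).filter (fun k => ¬ f k ≠ g (σ k)) := by
    ext k; simp only [Finset.mem_filter, Finset.mem_univ, true_and, not_not]
    constructor <;> rintro ⟨h1, h2⟩
    · exact ⟨h2 ▸ h1, h2⟩
    · exact ⟨h2 ▸ h1, h2⟩
  have e5 : (Finset.univ.filter (fun k => f k = i)).filter (fun k => f k ≠ g (σ k))
      = (Finset.univ.filter (fun k => f k ≠ g (σ k))).filter (fun k => f k = i) :=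
    Finset.filter_comm _ _ _
  rw [e4, e5] at e2
  rcases Finset.eq_empty_or_nonempty
    ((Finset.univ.filter (fun k => f k ≠ g (σ k))).filter (fun k => f k = i)) with h | ⟨k, hk⟩
  · rw [h]; simp
  · have h0 : (Finset.univ.filter (fun k => g (σ k) = i)).filter (fun k => f k ≠ g (σ k)) = ∅ := by
      rw [Finset.filter_eq_empty_iff]
      intro l hl hl'
      simp only [Finset.mem_filter, Finset.mem_univ, true_and] at hk hl
      exact key k l hk.1 hl' (hk.2.trans hl.symm)
    rw [h0, Finset.card_empty, zero_add] at e3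
    rw [e3] at e2
    rw [← e2]
    push_cast
    refine le_trans ?_ (le_abs_self _)
    simp

lemma empProb_apply {X : Type*} [MetricSpace X]
    [MeasurableSpace X] [BorelSpace X] (T : X → X) (x : X) (n : ℕ) (A : Set X) [DecidablePred (· ∈ A)] :
    ((empProb T x n A : ℝ≥0) : ℝ) =
      ((Finset.univ.filter (fun k : Fin (n+1) => T^[(k:ℕ)] x ∈ A)).card : ℝ) / ((n + 1 : ℕ) : ℝ) := by
  have h : (empProb T x n : Measure X) A
      = ((n + 1 : ℕ) : ℝ≥0∞)⁻¹ *
        ((Finset.univ.filter (fun k : Fin (n+1) => T^[(k:ℕ)] x ∈ A)).card : ℝ≥0∞) := by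
    show empMeas T x (n+1) A = _
    rw [empMeas, Measure.smul_apply, Measure.finset_sum_apply, smul_eq_mul]
    congr 1
    simp only [Measure.dirac_apply]
    rw [Finset.sum_range (fun j => A.indicator (1 : X → ℝ≥0∞) (T^[j] x)), Finset.card_filter]
    push_cast
    refine Finset.sum_congr rfl fun k _ => ?_
    simp [Set.indicator_apply]
  show ((empProb T x n : Measure X) A).toReal = _
  rw [h, ENNReal.toReal_mul, ENNReal.toReal_inv]
  simp only [ENNReal.toReal_natCast]
  rw [div_eq_inv_mul]

lemma empProb_integral {X : Type*} [MetricSpace X]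
    [MeasurableSpace X] [BorelSpace X] (T : X → X) (x : X) (n : ℕ) (f : X → ℝ) :
    ∫ z, f z ∂(empProb T x n : Measure X) =
      (1 / ((n + 1 : ℕ) : ℝ)) * ∑ k : Fin (n+1), f (T^[(k:ℕ)] x) := by
  show ∫ z, f z ∂(empMeas T x (n+1)) = _
  rw [empMeas, integral_smul_measure, integral_finset_sum_measure]
  · simp only [integral_dirac]
    rw [Finset.sum_range (fun j => f (T^[j] x))]
    rw [ENNReal.toReal_inv, ENNReal.toReal_natCast, smul_eq_mul, one_div]
  · intro i _
    exact integrable_dirac (by simp)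

lemma EnDist_nonneg {X : Type*} [MetricSpace X] (T : X → X) (n : ℕ) (x y : X) :
    0 ≤ EnDist T n x y :=
  Real.iInf_nonneg fun σ => by positivity

lemma EnDist_le {X : Type*} [MetricSpace X] (T : X → X) (n : ℕ) (x y : X)
    (σ : Equiv.Perm (Fin n)) :
    EnDist T n x y ≤ (1 / (n : ℝ)) * ∑ k : Fin n, dist (T^[(k : ℕ)] x) (T^[((σ k) : ℕ)] y) :=
  ciInf_le ⟨0, by rintro _ ⟨σ, rfl⟩; positivity⟩ σ

lemma EnDist_le_diam {X : Type*} [MetricSpace X] [CompactSpace X] (T : X → X) (n : ℕ) (x y : X) :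
    EnDist T n x y ≤ Metric.diam (Set.univ : Set X) := by
  refine (EnDist_le T n x y 1).trans ?_
  have h : ∑ k : Fin n, dist (T^[(k : ℕ)] x) (T^[(((1 : Equiv.Perm (Fin n)) k) : ℕ)] y)
      ≤ n * Metric.diam (Set.univ : Set X) := by
    refine (Finset.sum_le_card_nsmul _ _ (Metric.diam (Set.univ : Set X)) ?_).trans (by simp)
    intro k _
    exact Metric.dist_le_diam_of_mem isCompact_univ.isBounded trivial trivial
  rcases Nat.eq_zero_or_pos n with rfl | hn
  · simp [Metric.diam_nonneg]
  · rw [one_div, inv_mul_le_iff₀ (by exact_mod_cast hn)]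
    exact h

lemma Ebar_zero_iff {X : Type*} [MetricSpace X] [CompactSpace X] (T : X → X) (x y : X) :
    Ebar T x y = 0 ↔ Tendsto (fun n => EnDist T (n + 1) x y) atTop (𝓝 0) := by
  rw [tendsto_add_atTop_iff_nat (f := fun n => EnDist T n x y)]
  have hb : IsBoundedUnder (· ≤ ·) atTop (fun n => EnDist T n x y) :=
    isBoundedUnder_of ⟨_, fun n => EnDist_le_diam T n x y⟩
  have hb' : IsBoundedUnder (· ≥ ·) atTop (fun n => EnDist T n x y) :=
    isBoundedUnder_of ⟨0, fun n => EnDist_nonneg T n x y⟩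
  constructor
  · intro h
    refine tendsto_of_le_liminf_of_limsup_le ?_ h.le hb hb'
    exact le_liminf_of_le hb.isCoboundedUnder_ge (Eventually.of_forall fun n => EnDist_nonneg T n x y)
  · intro h; exact h.limsup_eq

lemma omegaHat_of_tendsto {X : Type*} [MetricSpace X] [CompactSpace X]
    [MeasurableSpace X] [BorelSpace X] (T : X → X) (x : X) (μ : ProbabilityMeasure X)
    (h : Tendsto (empProb T x) atTop (𝓝 μ)) : omegaHat T x = {μ} := by
  ext ν
  simp only [omegaHat, Set.mem_setOf_eq, Set.mem_singleton_iff]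
  constructor
  · intro hν
    have h1 : ClusterPt ν (𝓝 μ) := ClusterPt.mono hν h
    exact eq_of_nhds_neBot h1
  · rintro rfl
    exact h.mapClusterPt

lemma tendsto_of_EnDist {X : Type*} [MetricSpace X] [CompactSpace X]
    [MeasurableSpace X] [BorelSpace X] (T : X → X) (x y : X) (μ : ProbabilityMeasure X)
    (h : Tendsto (empProb T x) atTop (𝓝 μ))
    (hE : Tendsto (fun n => EnDist T (n + 1) x y) atTop (𝓝 0)) :
    Tendsto (empProb T y) atTop (𝓝 μ) := by
  rw [tendsto_iff_forall_lipschitz_integral_tendsto] at h ⊢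
  rintro f hf ⟨L, hL⟩
  have h1 := h f hf ⟨L, hL⟩
  refine h1.congr_dist ?_
  refine squeeze_zero (fun _ => dist_nonneg) (fun n => ?_) (by simpa using hE.const_mul (L : ℝ))
  rw [EnDist, Real.mul_iInf_of_nonneg L.coe_nonneg]
  refine le_ciInf fun σ => ?_
  rw [empProb_integral, empProb_integral, Real.dist_eq, ← mul_sub, abs_mul,
    ← Equiv.sum_comp σ (fun k => f (T^[(k:ℕ)] y)), ← Finset.sum_sub_distrib, mul_left_comm,
    abs_of_nonneg (by positivity : (0:ℝ) ≤ 1 / ((n + 1 : ℕ) : ℝ)), Finset.mul_sum]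
  gcongr
  refine (Finset.abs_sum_le_sum_abs _ _).trans (Finset.sum_le_sum fun k _ => ?_)
  exact hL.dist_le_mul _ _

lemma exists_code {X : Type*} [MetricSpace X] [CompactSpace X]
    [MeasurableSpace X] [BorelSpace X] (μ : Measure X) [IsProbabilityMeasure μ] {ε : ℝ}
    (hε : 0 < ε) : ∃ (s : Finset X) (c : X → (s → Prop)),
      (∀ z w, c z = c w → dist z w ≤ ε) ∧ ∀ i, μ (frontier {z | c z = i}) = 0 := by
  have h1 : ∀ z : X, ∃ r ∈ Set.Ioo 0 (ε / 2), μ (frontier (Metric.ball z r)) = 0 := by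
    intro z
    simpa only [Metric.thickening_singleton] using
      exists_null_frontier_thickening μ {z} (half_pos hε)
  choose r hr hr0 using h1
  obtain ⟨s, hs⟩ := CompactSpace.elim_nhds_subcover (fun z => Metric.ball z (r z))
    (fun z => Metric.ball_mem_nhds z (hr z).1)
  refine ⟨s, fun z p => z ∈ Metric.ball (p : X) (r p), ?_, ?_⟩
  · intro z w hzw
    have hz : z ∈ ⋃ p ∈ s, Metric.ball p (r p) := by
      have : z ∈ (⊤ : Set X) := trivial
      rwa [← hs] at this
    simp only [Set.mem_iUnion] at hz
    obtain ⟨p, hp, hz⟩ := hz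
    have hw : w ∈ Metric.ball p (r p) := (congrFun hzw ⟨p, hp⟩).mp hz
    have := dist_triangle_right z w p
    have := (hr p).2
    rw [Metric.mem_ball] at hz hw
    linarith
  · intro i
    refine measure_mono_null (t := ⋃ p : s, frontier (Metric.ball (p : X) (r p))) ?_
      (measure_iUnion_null fun p => hr0 p)
    intro z hz
    by_contra hcon
    simp only [Set.mem_iUnion, not_exists] at hcon
    have hev : ∀ p : s, ∀ᶠ w in 𝓝 z,
        (w ∈ Metric.ball (p : X) (r p)) = (z ∈ Metric.ball (p : X) (r p)) := by
      intro p
      have hp := hcon p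
      by_cases hzp : z ∈ Metric.ball (p : X) (r p)
      · filter_upwards [Metric.isOpen_ball.mem_nhds hzp] with w hw
        exact propext ⟨fun _ => hzp, fun _ => hw⟩
      · have : z ∉ closure (Metric.ball (p : X) (r p)) := by
          intro h
          exact hp ⟨h, fun h' => hzp (interior_subset h')⟩
        filter_upwards [isClosed_closure.isOpen_compl.mem_nhds this] with w hw
        exact propext ⟨fun h => absurd (subset_closure h) hw, fun h => absurd h hzp⟩
    have hall := eventually_all.mpr hev
    set A := {z : X | (fun p : s => z ∈ Metric.ball (p : X) (r p)) = i} with hA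
    by_cases hzA : z ∈ A
    · refine hz.2 (mem_interior_iff_mem_nhds.mpr ?_)
      filter_upwards [hall] with w hw
      exact (funext hw).trans hzA
    · have h2 := mem_closure_iff_frequently.mp hz.1
      refine h2 ?_
      filter_upwards [hall] with w hw hwA
      exact hzA ((funext hw).symm.trans hwA)

lemma EnDist_tendsto {X : Type*} [MetricSpace X] [CompactSpace X]
    [MeasurableSpace X] [BorelSpace X] (T : X → X) (x y : X) (μ : ProbabilityMeasure X)
    (hx : Tendsto (empProb T x) atTop (𝓝 μ)) (hy : Tendsto (empProb T y) atTop (𝓝 μ)) :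
    Tendsto (fun n => EnDist T (n + 1) x y) atTop (𝓝 0) := by
  classical
  set D := Metric.diam (Set.univ : Set X) with hD
  have hD0 : 0 ≤ D := Metric.diam_nonneg
  rw [Metric.tendsto_atTop']
  intro ε hε
  obtain ⟨s, c, hc, hc0⟩ := exists_code (μ : Measure X) (half_pos hε)
  have hlim : ∀ z, Tendsto (empProb T z) atTop (𝓝 μ) → ∀ i, Tendsto
      (fun n => ((empProb T z n {w | c w = i} : ℝ≥0) : ℝ)) atTop (𝓝 (μ {w | c w = i} : ℝ≥0)) := by
    intro z hz i
    refine (NNReal.tendsto_coe.mpr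
      (ProbabilityMeasure.tendsto_measure_of_null_frontier_of_tendsto hz ?_))
    simpa using hc0 i
  have hsum : Tendsto (fun n => D * ∑ i, |((empProb T x n {w | c w = i} : ℝ≥0) : ℝ)
      - ((empProb T y n {w | c w = i} : ℝ≥0) : ℝ)|) atTop (𝓝 0) := by
    have : Tendsto (fun n => D * ∑ i, |((empProb T x n {w | c w = i} : ℝ≥0) : ℝ)
      - ((empProb T y n {w | c w = i} : ℝ≥0) : ℝ)|) atTop (𝓝 (D * ∑ i : s → Prop,
        |((μ {w | c w = i} : ℝ≥0) : ℝ) - ((μ {w | c w = i} : ℝ≥0) : ℝ)|)) :=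
      (tendsto_finsetSum _ fun i _ => ((hlim x hx i).sub (hlim y hy i)).abs).const_mul D
    simpa using this
  obtain ⟨N, hN⟩ := (hsum.eventually_lt_const (half_pos hε)).exists_forall_of_atTop
  refine ⟨N, fun n hn => ?_⟩
  rw [Real.dist_eq, sub_zero, abs_of_nonneg (EnDist_nonneg _ _ _ _)]
  obtain ⟨σ, hσ⟩ := exists_perm_match (fun k : Fin (n+1) => c (T^[(k:ℕ)] x))
    (fun k : Fin (n+1) => c (T^[(k:ℕ)] y))
  have hn0 : (0:ℝ) < ((n + 1 : ℕ) : ℝ) := by positivity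
  set B := Finset.univ.filter
    (fun k : Fin (n+1) => c (T^[(k:ℕ)] x) ≠ c (T^[((σ k : Fin (n+1)):ℕ)] y)) with hB
  have hdist : ∑ k : Fin (n+1), dist (T^[(k : ℕ)] x) (T^[((σ k) : ℕ)] y)
      ≤ ((n + 1 : ℕ) : ℝ) * (ε / 2) + D * B.card := by
    calc _ ≤ ∑ k : Fin (n+1), (ε / 2 + D * if k ∈ B then 1 else 0) := by
          refine Finset.sum_le_sum fun k _ => ?_
          split_ifs with hk
          · have : dist (T^[(k : ℕ)] x) (T^[((σ k) : ℕ)] y) ≤ D :=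
              Metric.dist_le_diam_of_mem isCompact_univ.isBounded trivial trivial
            linarith
          · have hk' : c (T^[(k:ℕ)] x) = c (T^[((σ k : Fin (n+1)):ℕ)] y) := by
              simpa [hB] using hk
            have := hc _ _ hk'
            linarith
      _ = _ := by
          rw [Finset.sum_add_distrib, ← Finset.mul_sum, Finset.sum_boole]
          simp
  have hfin := hN n hn.le
  simp only [empProb_apply, Set.mem_setOf_eq, ← sub_div, abs_div, abs_of_pos hn0,
    ← Finset.sum_div] at hfin
  calc EnDist T (n+1) x y ≤ _ := EnDist_le T (n+1) x y σ
    _ ≤ (1 / ((n + 1 : ℕ) : ℝ)) * (((n + 1 : ℕ) : ℝ) * (ε / 2) + D * B.card) := by gcongr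
    _ = ε / 2 + D * (B.card / ((n + 1 : ℕ) : ℝ)) := by field_simp
    _ < ε / 2 + ε / 2 := by
        have h1 : D * (B.card / ((n + 1 : ℕ) : ℝ)) < ε / 2 := by
          refine lt_of_le_of_lt (mul_le_mul_of_nonneg_left ?_ hD0) hfin
          exact div_le_div_of_nonneg_right hσ hn0.le
        linarith
    _ = ε := by ring


/-- if `x` is a generic point, then for every `y`,
`ω̂_T(x) = ω̂_T(y)` if and only if `Ē(x,y) = 0`. -/
theorem omegaHat_eq_iff_Ebar_eq_zero_of_generic {X : Type*} [MetricSpace X] [CompactSpace X]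
    [MeasurableSpace X] [BorelSpace X] (T : X → X) (hT : Continuous T)
    (x : X) (hx : ∃ μ : ProbabilityMeasure X, Tendsto (empProb T x) atTop (𝓝 μ))
    (y : X) : omegaHat T x = omegaHat T y ↔ Ebar T x y = 0 := by
  obtain ⟨μ, hμ⟩ := hx
  rw [Ebar_zero_iff, omegaHat_of_tendsto T x μ hμ]
  constructor
  · intro h
    refine EnDist_tendsto T x y μ hμ (tendsto_nhds_of_unique_mapClusterPt fun ν hν => ?_)
    have : ν ∈ omegaHat T y := hν
    rw [← h] at this
    exact this
  · intro h
    rw [omegaHat_of_tendsto T y μ (tendsto_of_EnDist T x y μ hμ h)]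
end

section
/- If x is generic for an invariant measure μ and y is generic for an invariant measure ν, then Ē(x,y) = lim_{n→∞} Ē_n(x,y) = W_1(μ,ν); in particular the limsup defining Ē is a genuine limit in this case. -/
open Filter MeasureTheory Topology
open scoped ENNReal NNReal

/-- The Wasserstein distance `W₁(μ,ν)`: the infimum over all couplings `π` of `μ` and `ν`
of `∫ d(x,y) dπ(x,y)`. -/
noncomputable def W1 {X : Type*} [MetricSpace X] [MeasurableSpace X] (μ ν : Measure X) : ℝ :=
  sInf ((fun π : Measure (X × X) => ∫ p, dist p.1 p.2 ∂π) ''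
    {π | π.map Prod.fst = μ ∧ π.map Prod.snd = ν})


lemma perm_of_substochastic {N : ℕ} (Q c : Fin N → Fin N → ℝ) (D : ℝ)
    (hQ : ∀ k l, 0 ≤ Q k l) (hr : ∀ k, ∑ l, Q k l ≤ 1) (hc : ∀ l, ∑ k, Q k l ≤ 1)
    (hcD : ∀ k l, c k l ≤ D) :
    ∃ σ : Equiv.Perm (Fin N), ∑ k, c k (σ k) ≤
      ∑ k, ∑ l, Q k l * c k l + D * (N - ∑ k, ∑ l, Q k l) := by
  set s : ℝ := N - ∑ k, ∑ l, Q k l with hs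
  have hs1 : ∑ k, (1 - ∑ l, Q k l) = s := by simp [hs]
  have hs2 : ∑ l, (1 - ∑ k, Q k l) = s := by
    rw [hs, Finset.sum_comm]; simp
  have hs0 : 0 ≤ s := by
    rw [← hs1]; exact Finset.sum_nonneg fun k _ => sub_nonneg.2 (hr k)
  set R : Fin N → Fin N → ℝ := fun k l => (1 - ∑ l, Q k l) * (1 - ∑ k, Q k l) / s with hR
  have hR0 : ∀ k l, 0 ≤ R k l := fun k l =>
    div_nonneg (mul_nonneg (sub_nonneg.2 (hr k)) (sub_nonneg.2 (hc l))) hs0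
  have hRr : ∀ k, ∑ l, R k l = 1 - ∑ l, Q k l := by
    intro k
    simp only [hR]
    rw [← Finset.sum_div, ← Finset.mul_sum, hs2]
    rcases eq_or_ne s 0 with h | h
    · rw [h] at hs1
      have := (Finset.sum_eq_zero_iff_of_nonneg
        (fun k _ => sub_nonneg.2 (hr k))).1 hs1 k (Finset.mem_univ k)
      rw [this]; simp
    · field_simp
  have hRc : ∀ l, ∑ k, R k l = 1 - ∑ k, Q k l := by
    intro l
    simp only [hR]
    rw [← Finset.sum_div, ← Finset.sum_mul, hs1]
    rcases eq_or_ne s 0 with h | h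
    · rw [h] at hs2
      have := (Finset.sum_eq_zero_iff_of_nonneg
        (fun k _ => sub_nonneg.2 (hc k))).1 hs2 l (Finset.mem_univ l)
      rw [this]; simp
    · field_simp
  have hP : (Matrix.of fun k l => Q k l + R k l) ∈ doublyStochastic ℝ (Fin N) := by
    rw [mem_doublyStochastic_iff_sum]
    refine ⟨fun k l => add_nonneg (hQ k l) (hR0 k l), fun k => ?_, fun l => ?_⟩
    · simp [Finset.sum_add_distrib, hRr]
    · simp [Finset.sum_add_distrib, hRc]
  obtain ⟨w, hw0, hw1, hw⟩ := exists_eq_sum_perm_of_mem_doublyStochastic hP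
  have hcost : ∑ σ : Equiv.Perm (Fin N), w σ * ∑ k, c k (σ k)
      = ∑ k, ∑ l, (Q k l + R k l) * c k l := by
    have : ∀ k l, Q k l + R k l = ∑ σ : Equiv.Perm (Fin N), w σ * (if σ k = l then 1 else 0) := by
      intro k l
      have := congrFun (congrFun hw k) l
      rw [Matrix.of_apply] at this
      rw [← this, Matrix.sum_apply]
      refine Finset.sum_congr rfl fun σ _ => ?_
      simp [Equiv.Perm.permMatrix, PEquiv.toMatrix_apply, eq_comm]
    simp_rw [this, Finset.sum_mul, Finset.mul_sum]
    rw [Finset.sum_comm]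
    refine Finset.sum_congr rfl fun k _ => ?_
    rw [Finset.sum_comm]
    refine Finset.sum_congr rfl fun σ _ => ?_
    simp
  have hle : ∑ k, ∑ l, (Q k l + R k l) * c k l ≤ ∑ k, ∑ l, Q k l * c k l + D * s := by
    have : D * s = ∑ k, ∑ l, R k l * D := by
      simp_rw [← Finset.sum_mul, hRr, hs1, mul_comm]
    rw [this]
    simp_rw [← Finset.sum_add_distrib, add_mul]
    gcongr with k _ l _
    · exact hR0 k l
    · exact hcD k l
  by_contra! hcon
  have : ∑ σ : Equiv.Perm (Fin N), w σ * (∑ k, ∑ l, Q k l * c k l + D * s)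
      < ∑ σ : Equiv.Perm (Fin N), w σ * ∑ k, c k (σ k) := by
    obtain ⟨σ, -, hσ⟩ : ∃ σ ∈ Finset.univ, 0 < w σ := by
      apply Finset.exists_lt_of_sum_lt
      simp [hw1]
    exact Finset.sum_lt_sum (fun σ _ => mul_le_mul_of_nonneg_left (hcon σ).le (hw0 σ))
      ⟨σ, Finset.mem_univ _, mul_lt_mul_of_pos_left (hcon σ) hσ⟩
  rw [← Finset.sum_mul, hw1, hcost] at this
  linarith

lemma sum_swap4 {N : ℕ} {ι : Type*} [Fintype ι] (w : ι → ι → ℝ) (f g : ι → Fin N → ℝ) :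
    ∑ k, ∑ l, ∑ i, ∑ j, w i j * (f i k * g j l) =
      ∑ i, ∑ j, w i j * ((∑ k, f i k) * ∑ l, g j l) := by
  simp_rw [Finset.sum_mul_sum, Finset.mul_sum]
  calc _ = ∑ k, ∑ i, ∑ l, ∑ j, w i j * (f i k * g j l) :=
        Finset.sum_congr rfl fun k _ => Finset.sum_comm
    _ = ∑ i, ∑ k, ∑ l, ∑ j, w i j * (f i k * g j l) := Finset.sum_comm
    _ = ∑ i, ∑ k, ∑ j, ∑ l, w i j * (f i k * g j l) :=
        Finset.sum_congr rfl fun i _ => Finset.sum_congr rfl fun k _ => Finset.sum_comm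
    _ = _ := Finset.sum_congr rfl fun i _ => Finset.sum_comm

lemma row_le {N : ℕ} {ι : Type*} [Fintype ι] (w : ι → ι → ℝ) (g : ι → Fin N → ℝ) (u : ι → ℝ)
    (hu0 : ∀ i, 0 ≤ u i) (hu : ∑ i, u i = 1) (r t : ℝ)
    (h : ∀ i, t * ∑ j, w i j * ∑ l, g j l ≤ r) :
    ∑ l, t * ∑ i, ∑ j, w i j * (u i * g j l) ≤ r := by
  have : ∑ l, t * ∑ i, ∑ j, w i j * (u i * g j l)
      = ∑ i, u i * (t * ∑ j, w i j * ∑ l, g j l) := by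
    rw [← Finset.mul_sum, Finset.sum_comm, Finset.mul_sum]
    refine Finset.sum_congr rfl fun i _ => ?_
    rw [Finset.sum_comm]
    simp_rw [Finset.mul_sum]
    refine Finset.sum_congr rfl fun j _ => Finset.sum_congr rfl fun l _ => by ring
  rw [this]
  calc _ ≤ ∑ i, u i * r := Finset.sum_le_sum fun i _ => mul_le_mul_of_nonneg_left (h i) (hu0 i)
    _ = r := by rw [← Finset.sum_mul, hu, one_mul]

lemma exists_EnDist {X : Type*} [MetricSpace X] (T : X → X) (n : ℕ) (x y : X) :
    ∃ σ : Equiv.Perm (Fin n),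
    (1 / (n : ℝ)) * ∑ k : Fin n, dist (T^[(k : ℕ)] x) (T^[((σ k) : ℕ)] y) = EnDist T n x y :=
  exists_eq_ciInf_of_finite

lemma upper_aux {X : Type*} [MetricSpace X] [CompactSpace X] (T : X → X) (x y : X)
    {ι : Type*} [Fintype ι] (φ : ι → X → ℝ) (hφ0 : ∀ i u, 0 ≤ φ i u) (hφ1 : ∀ u, ∑ i, φ i u = 1)
    (pt : ι → X) (ε : ℝ) (hε : 0 < ε) (hφ : ∀ i u, φ i u ≠ 0 → dist u (pt i) ≤ ε)
    (m q : ι → ℝ) (p : ι → ι → ℝ) (hp : ∀ i j, 0 ≤ p i j) (hm : ∀ i, ∑ j, p i j = m i)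
    (hq : ∀ j, ∑ i, p i j = q j) (hm1 : ∑ i, m i = 1)
    (ha : ∀ i, Tendsto (fun n : ℕ => (((n + 1 : ℕ) : ℝ))⁻¹ * ∑ k : Fin (n + 1), φ i (T^[(k : ℕ)] x))
      atTop (𝓝 (m i)))
    (hb : ∀ i, Tendsto (fun n : ℕ => (((n + 1 : ℕ) : ℝ))⁻¹ * ∑ k : Fin (n + 1), φ i (T^[(k : ℕ)] y))
      atTop (𝓝 (q i))) :
    ∀ᶠ n : ℕ in atTop, EnDist T (n + 1) x y ≤ ∑ i, ∑ j, p i j * dist (pt i) (pt j) + 4 * ε := by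
  set D : ℝ := Metric.diam (Set.univ : Set X) with hD
  have hD0 : 0 ≤ D := Metric.diam_nonneg
  have hdD : ∀ u v : X, dist u v ≤ D := fun u v =>
    Metric.dist_le_diam_of_mem isCompact_univ.isBounded (Set.mem_univ _) (Set.mem_univ _)
  set δ : ℝ := ε / (D + 1) with hδ
  have hδ0 : 0 < δ := by positivity
  have hDδ : D * δ ≤ ε := by
    rw [hδ, mul_div_assoc', div_le_iff₀ (by positivity)]; nlinarith
  set s : ℝ := (1 + δ)⁻¹ with hs
  have hs0 : 0 < s := by positivity
  have hs1 : s * (1 + δ) = 1 := by rw [hs]; field_simp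
  have hs2 : s ≤ 1 := by nlinarith
  have hm0 : ∀ i, 0 ≤ m i := fun i => hm i ▸ Finset.sum_nonneg fun j _ => hp i j
  have hq0 : ∀ i, 0 ≤ q i := fun i => hq i ▸ Finset.sum_nonneg fun j _ => hp j i
  have hpm : ∀ i j, m i = 0 → p i j = 0 := fun i j h => by
    rw [← hm i] at h
    exact (Finset.sum_eq_zero_iff_of_nonneg fun j _ => hp i j).1 h j (Finset.mem_univ _)
  have hpq : ∀ i j, q j = 0 → p i j = 0 := fun i j h => by
    rw [← hq j] at h
    exact (Finset.sum_eq_zero_iff_of_nonneg fun i _ => hp i j).1 h i (Finset.mem_univ _)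
  set w : ι → ι → ℝ := fun i j => p i j / (m i * q j) with hw
  have hw0 : ∀ i j, 0 ≤ w i j := fun i j => div_nonneg (hp i j) (mul_nonneg (hm0 i) (hq0 j))
  have hwp : ∀ i j, w i j * (m i * q j) = p i j := by
    intro i j
    by_cases h1 : m i = 0
    · simp [h1, hpm i j h1]
    by_cases h2 : q j = 0
    · simp [h2, hpq i j h2]
    simp only [hw]; field_simp
  have hwr : ∀ i, ∑ j, w i j * q j ≤ 1 := by
    intro i
    by_cases h1 : m i = 0
    · simp [hw, h1]
    have : (∑ j, w i j * q j) * m i = 1 * m i := by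
      rw [Finset.sum_mul, one_mul, ← hm i]
      refine Finset.sum_congr rfl fun j _ => ?_
      rw [← hwp i j, hm i]; ring
    exact (mul_right_cancel₀ h1 this).le
  have hwc : ∀ j, ∑ i, w i j * m i ≤ 1 := by
    intro j
    by_cases h1 : q j = 0
    · simp [hw, h1]
    have : (∑ i, w i j * m i) * q j = 1 * q j := by
      rw [Finset.sum_mul, one_mul, ← hq j]
      refine Finset.sum_congr rfl fun i _ => ?_
      rw [← hwp i j, hq j]; ring
    exact (mul_right_cancel₀ h1 this).le
  set a : ι → ℕ → ℝ := fun i n => (((n + 1 : ℕ) : ℝ))⁻¹ * ∑ k : Fin (n + 1), φ i (T^[(k : ℕ)] x)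
    with ha'
  set b : ι → ℕ → ℝ := fun i n => (((n + 1 : ℕ) : ℝ))⁻¹ * ∑ k : Fin (n + 1), φ i (T^[(k : ℕ)] y)
    with hb'
  have e1 : ∀ᶠ n in atTop, ∀ i, ∑ j, w i j * b j n < 1 + δ := by
    rw [eventually_all]
    intro i
    have : Tendsto (fun n => ∑ j, w i j * b j n) atTop (𝓝 (∑ j, w i j * q j)) :=
      tendsto_finsetSum _ fun j _ => (hb j).const_mul _
    exact this.eventually_lt_const (by linarith [hwr i])
  have e2 : ∀ᶠ n in atTop, ∀ j, ∑ i, w i j * a i n < 1 + δ := by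
    rw [eventually_all]
    intro j
    have : Tendsto (fun n => ∑ i, w i j * a i n) atTop (𝓝 (∑ i, w i j * m i)) :=
      tendsto_finsetSum _ fun i _ => (ha i).const_mul _
    exact this.eventually_lt_const (by linarith [hwc j])
  have e3 : ∀ᶠ n in atTop, s * (∑ i, ∑ j, (w i j * (dist (pt i) (pt j) + 2 * ε)) * (a i n * b j n))
      + D * (1 - s * ∑ i, ∑ j, w i j * (a i n * b j n)) <
      ∑ i, ∑ j, p i j * dist (pt i) (pt j) + 4 * ε := by
    have l1 : Tendsto (fun n => ∑ i, ∑ j, (w i j * (dist (pt i) (pt j) + 2 * ε)) * (a i n * b j n))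
        atTop (𝓝 (∑ i, ∑ j, (w i j * (dist (pt i) (pt j) + 2 * ε)) * (m i * q j))) :=
      tendsto_finsetSum _ fun i _ => tendsto_finsetSum _ fun j _ =>
        ((ha i).mul (hb j)).const_mul _
    have l2 : Tendsto (fun n => ∑ i, ∑ j, w i j * (a i n * b j n))
        atTop (𝓝 (∑ i, ∑ j, w i j * (m i * q j))) :=
      tendsto_finsetSum _ fun i _ => tendsto_finsetSum _ fun j _ =>
        ((ha i).mul (hb j)).const_mul _
    have v2 : ∑ i, ∑ j, w i j * (m i * q j) = 1 := by simp_rw [hwp, hm, hm1]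
    have v1 : ∑ i, ∑ j, (w i j * (dist (pt i) (pt j) + 2 * ε)) * (m i * q j) =
        ∑ i, ∑ j, p i j * dist (pt i) (pt j) + 2 * ε := by
      have : ∀ i j, (w i j * (dist (pt i) (pt j) + 2 * ε)) * (m i * q j)
        = p i j * dist (pt i) (pt j) + p i j * (2 * ε) := by
        intro i j; rw [← hwp i j]; ring
      simp_rw [this, Finset.sum_add_distrib, ← Finset.sum_mul, hm, hm1, one_mul]
    rw [v1] at l1
    rw [v2] at l2
    refine ((l1.const_mul s).add (((l2.const_mul s).const_sub 1).const_mul D)).eventually_lt_const ?_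
    have hA : 0 ≤ ∑ i, ∑ j, p i j * dist (pt i) (pt j) :=
      Finset.sum_nonneg fun i _ => Finset.sum_nonneg fun j _ => mul_nonneg (hp i j) dist_nonneg
    have h1 : s * (∑ i, ∑ j, p i j * dist (pt i) (pt j) + 2 * ε) ≤
      1 * (∑ i, ∑ j, p i j * dist (pt i) (pt j) + 2 * ε) := by gcongr
    have h2 : D * (1 - s * 1) ≤ D * δ := by
      gcongr; nlinarith
    linarith
  filter_upwards [e1, e2, e3] with n h1 h2 h3
  set N : ℕ := n + 1 with hN
  have hN0 : (0 : ℝ) < (N : ℝ) := by positivity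
  set f : ι → Fin N → ℝ := fun i k => φ i (T^[(k : ℕ)] x) with hf
  set g : ι → Fin N → ℝ := fun i k => φ i (T^[(k : ℕ)] y) with hg
  have haN : ∀ i, ∑ k, f i k = N * a i n := by
    intro i; simp only [ha', hf]; rw [mul_inv_cancel_left₀ hN0.ne']
  have hbN : ∀ i, ∑ k, g i k = N * b i n := by
    intro i; simp only [hb', hg]; rw [mul_inv_cancel_left₀ hN0.ne']
  set Q : Fin N → Fin N → ℝ := fun k l => (s / N) * ∑ i, ∑ j, w i j * (f i k * g j l) with hQ
  have hsum : ∑ k, ∑ l, Q k l = N * (s * ∑ i, ∑ j, w i j * (a i n * b j n)) := by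
    simp only [hQ]
    simp_rw [← Finset.mul_sum]
    rw [sum_swap4]
    simp_rw [haN, hbN]
    simp_rw [Finset.mul_sum]
    refine Finset.sum_congr rfl fun i _ => Finset.sum_congr rfl fun j _ => by field_simp
  obtain ⟨σ, hσ⟩ := perm_of_substochastic Q
    (fun k l => dist (T^[(k : ℕ)] x) (T^[(l : ℕ)] y)) D
    (fun k l => mul_nonneg (by positivity) (Finset.sum_nonneg fun i _ => Finset.sum_nonneg fun j _ =>
      mul_nonneg (hw0 i j) (mul_nonneg (hφ0 _ _) (hφ0 _ _))))
    (fun k => row_le w g (fun i => f i k) (fun i => hφ0 _ _) (hφ1 _) 1 (s / N) (by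
      intro i
      simp_rw [hbN]
      have : s / N * ∑ j, w i j * (N * b j n) = s * ∑ j, w i j * b j n := by
        simp_rw [Finset.mul_sum]
        refine Finset.sum_congr rfl fun j _ => by field_simp
      rw [this, ← hs1]
      exact mul_le_mul_of_nonneg_left (h1 i).le hs0.le))
    (fun l => by
      have := row_le (fun j i => w i j) f (fun i => g i l) (fun i => hφ0 _ _) (hφ1 _) 1 (s / N)
        (by
          intro j
          simp_rw [haN]
          have : s / N * ∑ i, w i j * (N * a i n) = s * ∑ i, w i j * a i n := by
            simp_rw [Finset.mul_sum]
            refine Finset.sum_congr rfl fun j _ => by field_simp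
          rw [this, ← hs1]
          exact mul_le_mul_of_nonneg_left (h2 j).le hs0.le)
      refine le_trans (le_of_eq ?_) this
      refine Finset.sum_congr rfl fun k _ => ?_
      simp only [hQ]
      rw [Finset.sum_comm]
      congr 1
      refine Finset.sum_congr rfl fun j _ => Finset.sum_congr rfl fun i _ => by ring)
    (fun k l => hdD _ _)
  have hcost : ∑ k, ∑ l, Q k l * dist (T^[(k : ℕ)] x) (T^[(l : ℕ)] y) ≤
      N * (s * (∑ i, ∑ j, (w i j * (dist (pt i) (pt j) + 2 * ε)) * (a i n * b j n))) := by
    have : N * (s * (∑ i, ∑ j, (w i j * (dist (pt i) (pt j) + 2 * ε)) * (a i n * b j n)))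
      = ∑ k, ∑ l, (s / N) * ∑ i, ∑ j, (w i j * (dist (pt i) (pt j) + 2 * ε)) * (f i k * g j l) := by
      simp_rw [← Finset.mul_sum]
      rw [sum_swap4]
      simp_rw [haN, hbN]
      simp_rw [Finset.mul_sum]
      refine Finset.sum_congr rfl fun i _ => Finset.sum_congr rfl fun j _ => by field_simp
    rw [this]
    refine Finset.sum_le_sum fun k _ => Finset.sum_le_sum fun l _ => ?_
    simp only [hQ]
    rw [mul_assoc, Finset.sum_mul]
    simp_rw [Finset.sum_mul]
    refine mul_le_mul_of_nonneg_left (Finset.sum_le_sum fun i _ => Finset.sum_le_sum fun j _ => ?_)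
      (by positivity)
    by_cases hz : f i k = 0
    · simp [hz]
    by_cases hz' : g j l = 0
    · simp [hz']
    have d1 := hφ _ _ hz
    have d2 := hφ _ _ hz'
    have d3 : dist (T^[(k : ℕ)] x) (T^[(l : ℕ)] y) ≤ dist (pt i) (pt j) + 2 * ε := by
      have t1 := dist_triangle4 (T^[(k : ℕ)] x) (pt i) (pt j) (T^[(l : ℕ)] y)
      rw [dist_comm (pt j)] at t1
      linarith
    have : 0 ≤ w i j * (f i k * g j l) := mul_nonneg (hw0 i j) (mul_nonneg (hφ0 _ _) (hφ0 _ _))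
    calc _ ≤ w i j * (f i k * g j l) * (dist (pt i) (pt j) + 2 * ε) := by gcongr
      _ = _ := by ring
  refine (EnDist_le T N x y σ).trans (le_trans ?_ h3.le)
  rw [hsum] at hσ
  rw [one_div, inv_mul_le_iff₀ hN0]
  linarith

lemma integral_emp {X Y : Type*} [MeasurableSpace X] [MeasurableSpace Y] (N : ℕ)
    (z : Fin N → Y) (f : Y → ℝ) (hf : StronglyMeasurable f) :
    ∫ u, f u ∂(((N : ℝ≥0∞))⁻¹ • ∑ k : Fin N, Measure.dirac (z k)) =
      ((N : ℝ))⁻¹ * ∑ k, f (z k) := by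
  rw [integral_smul_measure, integral_finsetSum_measure]
  · simp_rw [integral_dirac' _ _ hf]
    simp
  · intro i _
    exact (integrable_dirac' hf (by simp))

lemma empMeas_fin {X : Type*} [MeasurableSpace X] (T : X → X) (x : X) (N : ℕ) :
    empMeas T x N = ((N : ℝ≥0∞))⁻¹ • ∑ k : Fin N, Measure.dirac (T^[(k : ℕ)] x) := by
  rw [empMeas, Finset.sum_range]

/-- Coupling of empirical measures given by a permutation. -/
noncomputable def permProb {X : Type*} [MeasurableSpace X] (T : X → X) (x y : X) (n : ℕ)
    (σ : Equiv.Perm (Fin (n + 1))) : ProbabilityMeasure (X × X) :=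
  ⟨(((n + 1 : ℕ) : ℝ≥0∞))⁻¹ • ∑ k : Fin (n + 1),
      Measure.dirac ((T^[(k : ℕ)] x, T^[((σ k) : ℕ)] y) : X × X), by
    constructor
    rw [Measure.smul_apply, Measure.finsetSum_apply]
    simp only [measure_univ, Finset.sum_const, Finset.card_univ, Fintype.card_fin, nsmul_eq_mul,
      mul_one, smul_eq_mul]
    rw [ENNReal.inv_mul_cancel (by exact_mod_cast Nat.succ_ne_zero n) (by simp)]⟩

lemma map_fst_permProb {X : Type*} [MeasurableSpace X] (T : X → X) (x y : X) (n : ℕ)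
    (σ : Equiv.Perm (Fin (n + 1))) :
    (permProb T x y n σ).toMeasure.map Prod.fst = empMeas T x (n + 1) := by
  rw [empMeas_fin]
  change Measure.map Prod.fst (_ • _) = _
  rw [Measure.map_smul, ← Measure.mapₗ_apply_of_measurable measurable_fst, map_sum]
  simp_rw [Measure.mapₗ_apply_of_measurable measurable_fst, Measure.map_dirac' measurable_fst]

lemma map_snd_permProb {X : Type*} [MeasurableSpace X] (T : X → X) (x y : X) (n : ℕ)
    (σ : Equiv.Perm (Fin (n + 1))) :
    (permProb T x y n σ).toMeasure.map Prod.snd = empMeas T y (n + 1) := by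
  rw [empMeas_fin]
  change Measure.map Prod.snd (_ • _) = _
  rw [Measure.map_smul, ← Measure.mapₗ_apply_of_measurable measurable_snd, map_sum]
  simp_rw [Measure.mapₗ_apply_of_measurable measurable_snd, Measure.map_dirac' measurable_snd]
  rw [Equiv.sum_comp σ (fun k => Measure.dirac (T^[(k : ℕ)] y))]

lemma W1_set_bdd {X : Type*} [MetricSpace X] [MeasurableSpace X] (μ ν : Measure X) :
    BddBelow ((fun π : Measure (X × X) => ∫ p, dist p.1 p.2 ∂π) ''
    {π | π.map Prod.fst = μ ∧ π.map Prod.snd = ν}) := by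
  refine ⟨0, ?_⟩
  rintro _ ⟨π, -, rfl⟩
  exact integral_nonneg fun p => dist_nonneg

lemma lower_bound {X : Type*} [MetricSpace X] [CompactSpace X]
    [MeasurableSpace X] [BorelSpace X] (T : X → X)
    (x y : X) (μ ν : ProbabilityMeasure X)
    (hx : Tendsto (empProb T x) atTop (𝓝 μ))
    (hy : Tendsto (empProb T y) atTop (𝓝 ν)) (c : ℝ) (hc : c < W1 μ.toMeasure ν.toMeasure) :
    ∀ᶠ n in atTop, c < EnDist T (n + 1) x y := by
  by_contra hcon
  rw [not_eventually] at hcon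
  choose σ hσ using fun n => exists_EnDist T (n + 1) x y
  set P : ℕ → ProbabilityMeasure (X × X) := fun n => permProb T x y n (σ n) with hP
  let F : Filter ℕ := atTop ⊓ 𝓟 {n | ¬ c < EnDist T (n + 1) x y}
  have hF : F.NeBot := frequently_mem_iff_neBot.1 hcon
  let U : Ultrafilter ℕ := Ultrafilter.of F
  have hUF : (U : Filter ℕ) ≤ F := Ultrafilter.of_le F
  have hUtop : (U : Filter ℕ) ≤ atTop := hUF.trans inf_le_left
  have hUc : ∀ᶠ n in (U : Filter ℕ), EnDist T (n + 1) x y ≤ c := by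
    have : ∀ᶠ n in F, EnDist T (n + 1) x y ≤ c := by
      filter_upwards [mem_inf_of_right (mem_principal_self _)] with n hn
      exact not_lt.1 hn
    exact hUF this
  obtain ⟨π, -, hπ⟩ := isCompact_univ.ultrafilter_le_nhds (U.map P) (by simp)
  have hlim : Tendsto P U (𝓝 π) := hπ
  have h1 : π.toMeasure.map Prod.fst = μ.toMeasure := by
    have l1 := ((ProbabilityMeasure.continuous_map (continuous_fst (X := X) (Y := X))).tendsto π).comp
      hlim
    have l2 : Tendsto (fun n => (P n).map continuous_fst.measurable.aemeasurable) U (𝓝 μ) := by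
      refine (hx.mono_left hUtop).congr fun n => ?_
      apply ProbabilityMeasure.toMeasure_injective
      exact (map_fst_permProb T x y n (σ n)).symm
    have := tendsto_nhds_unique l1 l2
    exact congrArg ProbabilityMeasure.toMeasure this
  have h2 : π.toMeasure.map Prod.snd = ν.toMeasure := by
    have l1 := ((ProbabilityMeasure.continuous_map (continuous_snd (X := X) (Y := X))).tendsto π).comp
      hlim
    have l2 : Tendsto (fun n => (P n).map continuous_snd.measurable.aemeasurable) U (𝓝 ν) := by
      refine (hy.mono_left hUtop).congr fun n => ?_
      apply ProbabilityMeasure.toMeasure_injective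
      exact (map_snd_permProb T x y n (σ n)).symm
    have := tendsto_nhds_unique l1 l2
    exact congrArg ProbabilityMeasure.toMeasure this
  have hd : Continuous fun p : X × X => dist p.1 p.2 := continuous_dist
  have l3 := ((ProbabilityMeasure.continuous_integral_continuousMap
    (⟨_, hd⟩ : C(X × X, ℝ))).tendsto π).comp hlim
  have h3 : ∫ p, dist p.1 p.2 ∂π.toMeasure ≤ c := by
    refine le_of_tendsto l3 ?_
    filter_upwards [hUc] with n hn
    refine le_trans (le_of_eq ?_) hn
    rw [← hσ n, one_div]
    exact integral_emp (X := X) (n + 1) (fun k => ((T^[(k : ℕ)] x, T^[((σ n k) : ℕ)] y) : X × X))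
      (fun p => dist p.1 p.2) hd.stronglyMeasurable
  have h4 : W1 μ.toMeasure ν.toMeasure ≤ ∫ p, dist p.1 p.2 ∂π.toMeasure :=
    csInf_le (W1_set_bdd _ _) ⟨π, ⟨h1, h2⟩, rfl⟩
  linarith

lemma tendsto_avg {X : Type*} [MetricSpace X] [CompactSpace X]
    [MeasurableSpace X] [BorelSpace X] (T : X → X)
    (x : X) (μ : ProbabilityMeasure X)
    (hx : Tendsto (empProb T x) atTop (𝓝 μ)) (f : C(X, ℝ)) :
    Tendsto (fun n : ℕ => (((n + 1 : ℕ) : ℝ))⁻¹ * ∑ k : Fin (n + 1), f (T^[(k : ℕ)] x))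
      atTop (𝓝 (∫ u, f u ∂μ.toMeasure)) := by
  have l := ((ProbabilityMeasure.continuous_integral_continuousMap f).tendsto μ).comp hx
  refine l.congr fun n => ?_
  rw [← integral_emp (X := X) (n + 1) (fun k => T^[(k : ℕ)] x) f f.continuous.stronglyMeasurable,
    ← empMeas_fin]
  rfl

lemma exists_partition {X : Type*} [MetricSpace X] [CompactSpace X] (ε : ℝ) (hε : 0 < ε) :
    ∃ (t : Set X) (_ : Fintype t) (φ : t → C(X, ℝ)), (∀ i u, 0 ≤ φ i u) ∧ (∀ u, ∑ i, φ i u = 1) ∧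
      ∀ i u, φ i u ≠ 0 → dist u (i : X) ≤ ε := by
  obtain ⟨t, -, ht, hcov⟩ := finite_cover_balls_of_compact
    (isCompact_univ : IsCompact (Set.univ : Set X)) hε
  obtain ⟨φ, hφ⟩ := PartitionOfUnity.exists_isSubordinate (ι := t) isClosed_univ
    (fun i => Metric.ball (i : X) ε) (fun i => Metric.isOpen_ball) (by
      simpa [Set.iUnion_subtype] using hcov)
  refine ⟨t, ht.fintype, fun i => φ i, fun i u => φ.nonneg i u, fun u => ?_, fun i u h => ?_⟩
  · letI := ht.fintype
    rw [← finsum_eq_sum_of_fintype]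
    exact φ.sum_eq_one (Set.mem_univ u)
  · exact (Metric.mem_ball.1 (hφ i (subset_tsupport _ h))).le

lemma upper_bound {X : Type*} [MetricSpace X] [CompactSpace X]
    [MeasurableSpace X] [BorelSpace X] (T : X → X)
    (x y : X) (μ ν : ProbabilityMeasure X)
    (hx : Tendsto (empProb T x) atTop (𝓝 μ))
    (hy : Tendsto (empProb T y) atTop (𝓝 ν)) (c : ℝ) (hc : W1 μ.toMeasure ν.toMeasure < c) :
    ∀ᶠ n in atTop, EnDist T (n + 1) x y < c := by
  have hne : ((fun π : Measure (X × X) => ∫ p, dist p.1 p.2 ∂π) ''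
      {π | π.map Prod.fst = μ.toMeasure ∧ π.map Prod.snd = ν.toMeasure}).Nonempty :=
    ⟨_, ⟨μ.toMeasure.prod ν.toMeasure, ⟨by simp, by simp⟩, rfl⟩⟩
  obtain ⟨_, ⟨π, ⟨hπ1, hπ2⟩, rfl⟩, hπc⟩ := exists_lt_of_csInf_lt hne hc
  have hprob : IsProbabilityMeasure π := by
    constructor
    have : (π.map Prod.fst) Set.univ = 1 := by rw [hπ1]; simp
    rwa [Measure.map_apply measurable_fst MeasurableSet.univ, Set.preimage_univ] at this
  set I : ℝ := ∫ p, dist p.1 p.2 ∂π with hI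
  change I < c at hπc
  obtain ⟨ε, hε, hεc⟩ : ∃ ε : ℝ, 0 < ε ∧ I + 6 * ε < c :=
    ⟨(c - I) / 7, by linarith, by linarith⟩
  obtain ⟨t, _, φ, hφ0, hφ1, hφ⟩ := exists_partition (X := X) ε hε
  have hint : ∀ f : X × X → ℝ, Continuous f → Integrable f π := fun f hf =>
    hf.integrable_of_hasCompactSupport (HasCompactSupport.of_compactSpace f)
  have hcφ : ∀ i j, Continuous fun p : X × X => φ i p.1 * φ j p.2 := fun i j => by fun_prop
  have key := upper_aux T x y (fun i => φ i) hφ0 hφ1 (fun i => (i : X)) ε hε hφ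
    (fun i => ∫ u, φ i u ∂μ.toMeasure) (fun i => ∫ u, φ i u ∂ν.toMeasure)
    (fun i j => ∫ p, φ i p.1 * φ j p.2 ∂π)
    (fun i j => integral_nonneg fun p => mul_nonneg (hφ0 _ _) (hφ0 _ _))
    (fun i => by
      rw [← integral_finsetSum _ fun j _ => hint _ (hcφ i j)]
      simp_rw [← Finset.mul_sum, hφ1, mul_one]
      rw [← hπ1, integral_map measurable_fst.aemeasurable
        (φ i).continuous.stronglyMeasurable.aestronglyMeasurable])
    (fun j => by
      rw [← integral_finsetSum _ fun i _ => hint _ (hcφ i j)]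
      simp_rw [← Finset.sum_mul, hφ1, one_mul]
      rw [← hπ2, integral_map measurable_snd.aemeasurable
        (φ j).continuous.stronglyMeasurable.aestronglyMeasurable])
    (by
      rw [← integral_finsetSum]
      · simp_rw [hφ1]; simp
      · intro i _
        exact (φ i).continuous.integrable_of_hasCompactSupport
          (HasCompactSupport.of_compactSpace _))
    (fun i => tendsto_avg T x μ hx (φ i)) (fun i => tendsto_avg T y ν hy (φ i))
  have hA : ∑ i, ∑ j, (∫ p, φ i p.1 * φ j p.2 ∂π) * dist (i : X) (j : X) ≤ I + 2 * ε := by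
    have hcd : ∀ i j : t, Continuous fun p : X × X => φ i p.1 * φ j p.2 * dist (i : X) (j : X) :=
      fun i j => by fun_prop
    have e : ∑ i, ∑ j, (∫ p, φ i p.1 * φ j p.2 ∂π) * dist (i : X) (j : X) =
        ∫ p, ∑ i, ∑ j, φ i p.1 * φ j p.2 * dist (i : X) (j : X) ∂π := by
      rw [integral_finsetSum _ fun i _ => integrable_finsetSum _ fun j _ => hint _ (hcd i j)]
      refine Finset.sum_congr rfl fun i _ => ?_
      rw [integral_finsetSum _ fun j _ => hint _ (hcd i j)]
      refine Finset.sum_congr rfl fun j _ => ?_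
      rw [integral_mul_const]
    have e2 : I + 2 * ε = ∫ p, (dist p.1 p.2 + 2 * ε) ∂π := by
      rw [integral_add (hint _ continuous_dist) (integrable_const _)]
      simp [hI]
    rw [e, e2]
    refine integral_mono (integrable_finsetSum _ fun i _ => integrable_finsetSum _ fun j _ =>
      hint _ (hcd i j)) (hint _ (by fun_prop)) fun p => ?_
    have s1 : ∑ i, ∑ j, φ i p.1 * φ j p.2 * (dist p.1 p.2 + 2 * ε) = dist p.1 p.2 + 2 * ε := by
      simp_rw [← Finset.sum_mul, ← Finset.mul_sum, hφ1]
      simp [hφ1]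
    change _ ≤ dist p.1 p.2 + 2 * ε
    rw [← s1]
    refine Finset.sum_le_sum fun i _ => Finset.sum_le_sum fun j _ => ?_
    by_cases hz : φ i p.1 = 0
    · simp [hz]
    by_cases hz' : φ j p.2 = 0
    · simp [hz']
    refine mul_le_mul_of_nonneg_left ?_ (mul_nonneg (hφ0 _ _) (hφ0 _ _))
    have d1 := hφ _ _ hz
    have d2 := hφ _ _ hz'
    have t1 := dist_triangle4 (i : X) p.1 p.2 (j : X)
    rw [dist_comm (i : X) p.1] at t1
    linarith
  filter_upwards [key] with n hn
  linarith

/-- if `x` is generic for an invariant measure `μ` and `y` is generic for an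
invariant measure `ν`, then `Ē(x,y) = lim_n Ē_n(x,y) = W₁(μ,ν)`; in particular the `limsup`
defining `Ē` is a genuine limit. -/
theorem Ebar_eq_wasserstein_of_generic {X : Type*} [MetricSpace X] [CompactSpace X]
    [MeasurableSpace X] [BorelSpace X] (T : X → X) (hT : Continuous T)
    (x y : X) (μ ν : ProbabilityMeasure X)
    (hμinv : Measure.map T μ.toMeasure = μ.toMeasure)
    (hνinv : Measure.map T ν.toMeasure = ν.toMeasure)
    (hx : Tendsto (empProb T x) atTop (𝓝 μ))
    (hy : Tendsto (empProb T y) atTop (𝓝 ν)) :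
    Tendsto (fun n => EnDist T n x y) atTop (𝓝 (W1 μ.toMeasure ν.toMeasure)) ∧
      Ebar T x y = W1 μ.toMeasure ν.toMeasure := by
  have h : Tendsto (fun n => EnDist T n x y) atTop (𝓝 (W1 μ.toMeasure ν.toMeasure)) := by
    rw [← tendsto_add_atTop_iff_nat 1]
    exact tendsto_order.2 ⟨fun c hc => lower_bound T x y μ ν hx hy c hc,
      fun c hc => upper_bound T x y μ ν hx hy c hc⟩
  exact ⟨h, h.limsup_eq⟩
end

section
/- Let x = 0^{a_1}1^{a_2}0^{a_3}1^{a_4}… and y = 1^{a_1}0^{a_2}1^{a_3}0^{a_4}… be points of the full shift {0,1}^ℕ, where (a_n) is a sequence of positive integers with (a_1+…+a_n)/a_{n+1} → 0. Then Ē(x,y) = 1 with respect to the shift map and the standard metric d(u,v)=2^{-min{i: u_i≠v_i}}, while ω̂_S(x) = ω̂_S(y) = {α δ_{0̄} + (1−α) δ_{1̄} : α ∈ [0,1]}. -/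
open Filter MeasureTheory Topology
open scoped ENNReal NNReal

/-- The space of binary sequences `{0,1}^ℕ`, as a type synonym (so that the metric and
measurable structures below can be specified by hypotheses). -/
def BSeq : Type := ℕ → Bool

/-- Evaluation of a binary sequence at an index. -/
def BSeq.ap (u : BSeq) (i : ℕ) : Bool := u i

-- HELPERS
section Helpers

lemma hp_iter (S : BSeq → BSeq) (hS : ∀ (u : BSeq) (n : ℕ), (S u).ap n = u.ap (n + 1))
    (u : BSeq) (k n : ℕ) : (S^[k] u).ap n = u.ap (n + k) := by
  induction k generalizing n with
  | zero => rfl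
  | succ k ih => rw [Function.iterate_succ_apply', hS, ih]; congr 1; omega

lemma hp_dist_le [MetricSpace BSeq]
    (hd : ∀ u v : BSeq, u ≠ v →
      dist u v = (2 : ℝ) ^ (-((sInf {i : ℕ | u.ap i ≠ v.ap i} : ℕ) : ℤ)))
    (u v : BSeq) (L : ℕ) (h : ∀ i < L, u.ap i = v.ap i) : dist u v ≤ (1 / 2 : ℝ) ^ L := by
  by_cases huv : u = v
  · subst huv; simp
  · rw [hd u v huv, zpow_neg, zpow_natCast, one_div, inv_pow]
    have hne : {i : ℕ | u.ap i ≠ v.ap i}.Nonempty := by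
      by_contra hc
      rw [Set.not_nonempty_iff_eq_empty] at hc
      apply huv
      funext i
      by_contra hi
      have : i ∈ {i : ℕ | u.ap i ≠ v.ap i} := hi
      rw [hc] at this
      exact this
    have hL : L ≤ sInf {i : ℕ | u.ap i ≠ v.ap i} := by
      by_contra hlt
      push Not at hlt
      exact Nat.sInf_mem hne (h _ hlt)
    gcongr
    norm_num

lemma hp_dist_one [MetricSpace BSeq]
    (hd : ∀ u v : BSeq, u ≠ v →
      dist u v = (2 : ℝ) ^ (-((sInf {i : ℕ | u.ap i ≠ v.ap i} : ℕ) : ℤ)))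
    (u v : BSeq) (h : u.ap 0 ≠ v.ap 0) : dist u v = 1 := by
  have huv : u ≠ v := by rintro rfl; exact h rfl
  rw [hd u v huv]
  have : sInf {i : ℕ | u.ap i ≠ v.ap i} = 0 := Nat.sInf_eq_zero.2 (Or.inl h)
  rw [this]; simp

lemma hp_smono (a : ℕ → ℕ) (ha : ∀ n, 0 < a n) :
    StrictMono (fun m => ∑ i ∈ Finset.range m, a i) := by
  apply strictMono_nat_of_lt_succ
  intro n
  rw [Finset.sum_range_succ]
  have := ha n
  omega

lemma hp_blk (a : ℕ → ℕ) (ha : ∀ n, 0 < a n) (n : ℕ) :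
    ∃ b, (∑ i ∈ Finset.range b, a i) ≤ n ∧ n < ∑ i ∈ Finset.range (b + 1), a i := by
  induction n with
  | zero => exact ⟨0, by simp, by simpa using ha 0⟩
  | succ n ih =>
    obtain ⟨b, h1, h2⟩ := ih
    by_cases h : n + 1 < ∑ i ∈ Finset.range (b + 1), a i
    · exact ⟨b, by omega, h⟩
    · refine ⟨b + 1, by omega, ?_⟩
      have := hp_smono a ha (Nat.lt_succ_self (b + 1))
      simp only [Nat.succ_eq_add_one] at this
      omega

lemma hp_ratio (a : ℕ → ℕ) (ha : ∀ n, 0 < a n)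
    (hlim : Tendsto (fun n => (∑ i ∈ Finset.range n, (a i : ℝ)) / (a n : ℝ)) atTop (𝓝 0)) :
    Tendsto (fun n => ((∑ i ∈ Finset.range n, a i : ℕ) : ℝ) /
      ((∑ i ∈ Finset.range (n + 1), a i : ℕ) : ℝ)) atTop (𝓝 0) := by
  refine squeeze_zero (fun n => by positivity) (fun n => ?_) hlim
  have : (0 : ℝ) < a n := by exact_mod_cast ha n
  rw [Finset.sum_range_succ]
  push_cast
  gcongr
  have : (0 : ℝ) ≤ ∑ i ∈ Finset.range n, (a i : ℝ) := by positivity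
  linarith

lemma hp_blkratio (a : ℕ → ℕ) (ha : ∀ n, 0 < a n)
    (hlim : Tendsto (fun n => (∑ i ∈ Finset.range n, (a i : ℝ)) / (a n : ℝ)) atTop (𝓝 0)) :
    Tendsto (fun n : ℕ => ((n : ℝ) + 1) / ((∑ i ∈ Finset.range n, a i : ℕ) : ℝ)) atTop (𝓝 0) := by
  rw [← tendsto_add_atTop_iff_nat 1]
  have hr := hp_ratio a ha hlim
  have h1 : Tendsto (fun n : ℕ => 2 * (1 / ((n : ℝ) + 1))) atTop (𝓝 0) := by
    simpa using (tendsto_one_div_add_atTop_nhds_zero_nat (𝕜 := ℝ)).const_mul 2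
  have h2 := hr.add h1
  rw [add_zero] at h2
  refine squeeze_zero (fun n => by positivity) (fun n => ?_) h2
  have e1 : (n : ℝ) ≤ ((∑ i ∈ Finset.range n, a i : ℕ) : ℝ) := by
    exact_mod_cast (hp_smono a ha).le_apply
  have e2 : (n : ℝ) + 1 ≤ ((∑ i ∈ Finset.range (n + 1), a i : ℕ) : ℝ) := by
    exact_mod_cast (hp_smono a ha).le_apply (x := n + 1)
  have hpos : (0 : ℝ) < n + 1 := by positivity
  have e3 : (((n + 1 : ℕ) : ℝ) + 1) / ((∑ i ∈ Finset.range (n + 1), a i : ℕ) : ℝ)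
      = (n : ℝ) / ((∑ i ∈ Finset.range (n + 1), a i : ℕ) : ℝ)
        + 2 * (1 / ((∑ i ∈ Finset.range (n + 1), a i : ℕ) : ℝ)) := by
    push_cast; ring
  rw [e3]
  gcongr

lemma hp_Ebar [MetricSpace BSeq]
    (hd : ∀ u v : BSeq, u ≠ v →
      dist u v = (2 : ℝ) ^ (-((sInf {i : ℕ | u.ap i ≠ v.ap i} : ℕ) : ℤ)))
    (S : BSeq → BSeq) (hS : ∀ (u : BSeq) (n : ℕ), (S u).ap n = u.ap (n + 1))
    (a : ℕ → ℕ) (ha : ∀ n, 0 < a n)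
    (hlim : Tendsto (fun n => (∑ i ∈ Finset.range n, (a i : ℝ)) / (a n : ℝ)) atTop (𝓝 0))
    (x y : BSeq)
    (hx : ∀ n k : ℕ, (∑ i ∈ Finset.range n, a i) ≤ k → k < ∑ i ∈ Finset.range (n + 1), a i →
      x.ap k = (n % 2 == 1))
    (hy : ∀ n k : ℕ, (∑ i ∈ Finset.range n, a i) ≤ k → k < ∑ i ∈ Finset.range (n + 1), a i →
      y.ap k = (n % 2 == 0)) : Ebar S x y = 1 := by
  have hd1 : ∀ u v : BSeq, dist u v ≤ 1 := fun u v => by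
    simpa using hp_dist_le hd u v 0 (by simp)
  have hbdd : ∀ n, BddBelow (Set.range (fun σ : Equiv.Perm (Fin n) =>
      (1 / (n : ℝ)) * ∑ k : Fin n, dist (S^[(k : ℕ)] x) (S^[((σ k) : ℕ)] y))) := by
    intro n
    refine ⟨0, ?_⟩
    rintro _ ⟨σ, rfl⟩
    positivity
  have hle : ∀ n, EnDist S n x y ≤ 1 := by
    intro n
    refine (ciInf_le (hbdd n) 1).trans ?_
    have : ∑ k : Fin n, dist (S^[(k : ℕ)] x) (S^[(((1 : Equiv.Perm (Fin n)) k) : ℕ)] y) ≤ n := by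
      refine (Finset.sum_le_sum (fun k _ => hd1 _ _)).trans ?_
      simp
    rw [one_div, inv_mul_eq_div]
    exact div_le_one_of_le₀ this (by positivity)
  have hge0 : ∀ n, 0 ≤ EnDist S n x y := fun n => le_ciInf (fun σ => by positivity)
  have hlow : ∀ m, 1 - 2 * (((∑ i ∈ Finset.range m, a i : ℕ) : ℝ) /
      ((∑ i ∈ Finset.range (m + 1), a i : ℕ) : ℝ)) ≤
      EnDist S (∑ i ∈ Finset.range (m + 1), a i) x y := by
    intro m
    have hlt := hp_smono a ha (Nat.lt_succ_self m)
    simp only [Nat.succ_eq_add_one] at hlt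
    have hxm := hx m
    have hym := hy m
    generalize (∑ i ∈ Finset.range (m + 1), a i) = N at *
    generalize (∑ i ∈ Finset.range m, a i) = s at *
    refine le_ciInf (fun σ => ?_)
    have hN : (0 : ℝ) < N := by exact_mod_cast (by omega : 0 < N)
    have hsum : ∑ k : Fin N, (if (k : ℕ) < s then (1 : ℝ) else 0) = s := by
      rw [Fin.sum_univ_eq_sum_range (fun k => if k < s then (1 : ℝ) else 0), ← Finset.sum_filter]
      have : (Finset.range N).filter (fun k => k < s) = Finset.range s := by
        ext k; simp; omega
      rw [this]; simp
    have hsum' : ∑ k : Fin N, (if ((σ k : Fin N) : ℕ) < s then (1 : ℝ) else 0) = s := by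
      rw [← hsum]
      exact Equiv.sum_comp σ (fun k : Fin N => if (k : ℕ) < s then (1 : ℝ) else 0)
    have hpt : ∑ k : Fin N, (1 - (if (k : ℕ) < s then (1 : ℝ) else 0)
        - (if ((σ k : Fin N) : ℕ) < s then (1 : ℝ) else 0)) ≤
        ∑ k : Fin N, dist (S^[(k : ℕ)] x) (S^[((σ k) : ℕ)] y) := by
      refine Finset.sum_le_sum (fun k _ => ?_)
      have h0 : 0 ≤ dist (S^[(k : ℕ)] x) (S^[((σ k) : ℕ)] y) := dist_nonneg
      by_cases h1 : (k : ℕ) < s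
      · simp only [h1, if_true]; split_ifs <;> linarith
      · by_cases h2 : ((σ k : Fin N) : ℕ) < s
        · simp only [h2, if_true]; split_ifs <;> linarith
        · rw [hp_dist_one hd]
          · simp [h1, h2]
          · rw [hp_iter S hS, hp_iter S hS, zero_add, zero_add, hxm _ (by omega) k.2,
              hym _ (by omega) (σ k).2]
            rcases Nat.mod_two_eq_zero_or_one m with h | h <;> simp [h]
    rw [Finset.sum_sub_distrib, Finset.sum_sub_distrib, hsum, hsum'] at hpt
    simp only [Finset.sum_const, Finset.card_univ, Fintype.card_fin, nsmul_eq_mul, mul_one] at hpt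
    calc _ = (1 / (N : ℝ)) * (N - s - s) := by field_simp; ring
      _ ≤ _ := by gcongr
  have hbu : IsBoundedUnder (· ≤ ·) atTop (fun n => EnDist S n x y) :=
    isBoundedUnder_of ⟨1, hle⟩
  have hbl : IsBoundedUnder (· ≥ ·) atTop (fun n => EnDist S n x y) :=
    isBoundedUnder_of ⟨0, hge0⟩
  unfold Ebar
  apply le_antisymm
  · exact limsup_le_of_le hbl.isCoboundedUnder_le (Eventually.of_forall hle)
  · refine le_of_forall_pos_le_add (fun ε hε => ?_)
    rw [← sub_le_iff_le_add]
    refine le_limsup_of_frequently_le ?_ hbu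
    have hev := (hp_ratio a ha hlim).eventually (gt_mem_nhds (by positivity : (0 : ℝ) < ε / 2))
    have ht : Tendsto (fun m => ∑ i ∈ Finset.range (m + 1), a i) atTop atTop :=
      (hp_smono a ha).tendsto_atTop.comp (tendsto_add_atTop_nat 1)
    refine ht.frequently (Eventually.frequently ?_)
    filter_upwards [hev] with m hm
    have := hlow m
    linarith

/-- Fraction of zeros among the first `n + 1` symbols. -/
noncomputable def hpA (z : BSeq) (n : ℕ) : ℝ :=
  (∑ j ∈ Finset.range (n + 1), if z.ap j then (0 : ℝ) else 1) / ((n : ℝ) + 1)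

lemma hpA_nonneg (z : BSeq) (n : ℕ) : 0 ≤ hpA z n := by
  unfold hpA
  refine div_nonneg (Finset.sum_nonneg fun j _ => ?_) (by positivity)
  split_ifs <;> norm_num

lemma hpA_le_one (z : BSeq) (n : ℕ) : hpA z n ≤ 1 := by
  unfold hpA
  refine div_le_one_of_le₀ ?_ (by positivity)
  refine (Finset.sum_le_sum (g := fun _ => (1 : ℝ)) fun j _ => ?_).trans (by simp)
  split_ifs <;> norm_num

lemma hpA_succ (z : BSeq) (n : ℕ) : hpA z (n + 1) ≤ hpA z n + 1 / ((n : ℝ) + 1) := by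
  unfold hpA
  rw [Finset.sum_range_succ, ← add_div]
  have h0 : 0 ≤ ∑ j ∈ Finset.range (n + 1), if z.ap j then (0 : ℝ) else 1 :=
    Finset.sum_nonneg fun j _ => by split_ifs <;> norm_num
  push_cast
  gcongr
  · split_ifs <;> norm_num
  · linarith

lemma hpA_block (a : ℕ → ℕ) (ha : ∀ n, 0 < a n) (z : BSeq) (p : ℕ → Bool)
    (hz : ∀ n k : ℕ, (∑ i ∈ Finset.range n, a i) ≤ k → k < ∑ i ∈ Finset.range (n + 1), a i →
      z.ap k = p n) (m : ℕ) :
    |hpA z ((∑ i ∈ Finset.range (m + 1), a i) - 1) - (if p m then 0 else 1)| ≤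
      ((∑ i ∈ Finset.range m, a i : ℕ) : ℝ) / ((∑ i ∈ Finset.range (m + 1), a i : ℕ) : ℝ) := by
  have hlt := hp_smono a ha (Nat.lt_succ_self m)
  simp only [Nat.succ_eq_add_one] at hlt
  have hzm := hz m
  generalize (∑ i ∈ Finset.range (m + 1), a i) = N at *
  generalize (∑ i ∈ Finset.range m, a i) = s at *
  obtain ⟨N, rfl⟩ : ∃ k, N = k + 1 := ⟨N - 1, by omega⟩
  unfold hpA
  simp only [Nat.add_sub_cancel]
  have hN : (0 : ℝ) < (N : ℝ) + 1 := by positivity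
  have hc : (if p m then (0 : ℝ) else 1) =
      (∑ j ∈ Finset.range (N + 1), if p m then (0 : ℝ) else 1) / ((N : ℝ) + 1) := by
    simp only [Finset.sum_const, Finset.card_range, nsmul_eq_mul]
    push_cast; field_simp
  rw [hc, ← sub_div, ← Finset.sum_sub_distrib, abs_div, abs_of_pos hN]
  push_cast
  gcongr
  refine (Finset.abs_sum_le_sum_abs _ _).trans ?_
  have hsum : ∑ j ∈ Finset.range (N + 1), (if j < s then (1 : ℝ) else 0) = s := by
    rw [← Finset.sum_filter]
    have : (Finset.range (N + 1)).filter (fun k => k < s) = Finset.range s := by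
      ext k; simp; omega
    rw [this]; simp
  rw [← hsum]
  refine Finset.sum_le_sum fun j hj => ?_
  by_cases h : j < s
  · simp only [h, if_true]; split_ifs <;> norm_num
  · rw [hzm j (by omega) (Finset.mem_range.1 hj)]; simp [h]

lemma hpA_cluster (a : ℕ → ℕ) (ha : ∀ n, 0 < a n)
    (hlim : Tendsto (fun n => (∑ i ∈ Finset.range n, (a i : ℝ)) / (a n : ℝ)) atTop (𝓝 0))
    (z : BSeq) (p : ℕ → Bool) (hp : ∀ n, p (n + 1) = !p n)
    (hz : ∀ n k : ℕ, (∑ i ∈ Finset.range n, a i) ≤ k → k < ∑ i ∈ Finset.range (n + 1), a i →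
      z.ap k = p n) (α : ℝ) (h0 : 0 ≤ α) (h1 : α ≤ 1) :
    MapClusterPt α atTop (hpA z) := by
  have key : ∀ (b : Bool) (ε : ℝ), 0 < ε → ∀ n0 : ℕ, ∃ n ≥ n0,
      |hpA z n - (if b then 0 else 1)| < ε := by
    intro b ε hε n0
    obtain ⟨M, hM⟩ := eventually_atTop.1
      ((hp_ratio a ha hlim).eventually (gt_mem_nhds hε))
    obtain ⟨m, hm, hpm⟩ : ∃ m ≥ max M (n0 + 1), p m = b := by
      by_cases h : p (max M (n0 + 1)) = b
      · exact ⟨_, le_rfl, h⟩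
      · refine ⟨max M (n0 + 1) + 1, by omega, ?_⟩
        rw [hp]
        revert h
        cases p (max M (n0 + 1)) <;> cases b <;> simp
    refine ⟨(∑ i ∈ Finset.range (m + 1), a i) - 1, ?_, ?_⟩
    · have : m + 1 ≤ ∑ i ∈ Finset.range (m + 1), a i := (hp_smono a ha).le_apply (x := m + 1)
      omega
    · rw [← hpm]
      exact (hpA_block a ha z p hz m).trans_lt (hM m (by omega))
  rw [mapClusterPt_iff_frequently]
  intro s hs
  obtain ⟨ε, hε, hball⟩ := Metric.mem_nhds_iff.1 hs
  rw [frequently_atTop]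
  intro n0
  by_contra hcon
  push Not at hcon
  have hfar : ∀ n ≥ n0, ε ≤ |hpA z n - α| := by
    intro n hn
    by_contra hlt
    push Not at hlt
    exact hcon n hn (hball (by rwa [Metric.mem_ball, Real.dist_eq]))
  obtain ⟨n1, hn1⟩ := exists_nat_one_div_lt hε
  obtain ⟨n2, hn2, hA2⟩ := key true ε hε (max n0 n1)
  have hind : ∀ n ≥ n2, hpA z n ≤ α - ε := by
    intro n hn
    induction n, hn using Nat.le_induction with
    | base =>
      have := hfar n2 (by omega)
      simp only [if_true, sub_zero, abs_lt] at hA2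
      rcases le_abs.1 this with h | h <;> linarith
    | succ n hn ih =>
      have := hfar (n + 1) (by omega)
      have hs := hpA_succ z n
      have : 1 / ((n : ℝ) + 1) ≤ 1 / ((n1 : ℝ) + 1) := by
        have : (n1 : ℝ) ≤ n := by exact_mod_cast (by omega : n1 ≤ n)
        gcongr
      rcases le_abs.1 (hfar (n + 1) (by omega)) with h | h <;> linarith
  obtain ⟨n3, hn3, hA3⟩ := key false ε hε n2
  have := hind n3 hn3
  simp only [Bool.false_eq_true, if_false, abs_lt] at hA3
  linarith

lemma hp_avg [MetricSpace BSeq]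
    (hd : ∀ u v : BSeq, u ≠ v →
      dist u v = (2 : ℝ) ^ (-((sInf {i : ℕ | u.ap i ≠ v.ap i} : ℕ) : ℤ)))
    (S : BSeq → BSeq) (hS : ∀ (u : BSeq) (n : ℕ), (S u).ap n = u.ap (n + 1))
    (a : ℕ → ℕ) (ha : ∀ n, 0 < a n)
    (hlim : Tendsto (fun n => (∑ i ∈ Finset.range n, (a i : ℝ)) / (a n : ℝ)) atTop (𝓝 0))
    (z : BSeq) (p : ℕ → Bool)
    (hz : ∀ n k : ℕ, (∑ i ∈ Finset.range n, a i) ≤ k → k < ∑ i ∈ Finset.range (n + 1), a i →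
      z.ap k = p n)
    (zeroSeq oneSeq : BSeq) (hzero : ∀ i, zeroSeq.ap i = false) (ho : ∀ i, oneSeq.ap i = true)
    (f : BoundedContinuousFunction BSeq ℝ) :
    Tendsto (fun n : ℕ => (∑ j ∈ Finset.range (n + 1), f (S^[j] z)) / ((n : ℝ) + 1) -
      (hpA z n * f zeroSeq + (1 - hpA z n) * f oneSeq)) atTop (𝓝 0) := by
  have hrew : ∀ n : ℕ, (∑ j ∈ Finset.range (n + 1), f (S^[j] z)) / ((n : ℝ) + 1) -
      (hpA z n * f zeroSeq + (1 - hpA z n) * f oneSeq) =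
      (∑ j ∈ Finset.range (n + 1), (f (S^[j] z) - f (if z.ap j then oneSeq else zeroSeq)))
        / ((n : ℝ) + 1) := by
    intro n
    have hN : ((n : ℝ) + 1) ≠ 0 := by positivity
    have : ∑ j ∈ Finset.range (n + 1), f (if z.ap j then oneSeq else zeroSeq) =
        ∑ j ∈ Finset.range (n + 1), (f oneSeq +
          (if z.ap j then (0 : ℝ) else 1) * (f zeroSeq - f oneSeq)) := by
      refine Finset.sum_congr rfl fun j _ => ?_
      split_ifs <;> ring
    rw [Finset.sum_sub_distrib, this, Finset.sum_add_distrib, ← Finset.sum_mul]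
    unfold hpA
    simp only [Finset.sum_const, Finset.card_range, nsmul_eq_mul]
    push_cast
    field_simp
    ring
  simp only [hrew]
  choose b hb1 hb2 using hp_blk a ha
  have hbt : Tendsto b atTop atTop := by
    rw [tendsto_atTop]
    intro M
    filter_upwards [eventually_ge_atTop (∑ i ∈ Finset.range (M + 1), a i)] with n hn
    have := (hp_smono a ha).lt_iff_lt.1 (lt_of_le_of_lt hn (hb2 n))
    omega
  have hbr := (hp_blkratio a ha hlim).comp hbt
  rw [Metric.tendsto_atTop]
  intro ε hε
  -- closeness scale
  obtain ⟨L, hL⟩ : ∃ L : ℕ, ∀ (c : Bool) (u : BSeq), (∀ i < L, u.ap i = c) →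
      |f u - f (if c then oneSeq else zeroSeq)| ≤ ε / 2 := by
    have hc : ∀ w : BSeq, ∃ L : ℕ, ∀ u : BSeq, (∀ i < L, u.ap i = w.ap i) →
        |f u - f w| ≤ ε / 2 := by
      intro w
      obtain ⟨δ, hδ, h⟩ := Metric.continuousAt_iff.1 (f.continuous.continuousAt (x := w)) (ε / 2)
        (by positivity)
      obtain ⟨L, hL⟩ := exists_pow_lt_of_lt_one hδ (by norm_num : (1 / 2 : ℝ) < 1)
      refine ⟨L, fun u hu => ?_⟩
      have := h ((hp_dist_le hd u w L hu).trans_lt hL)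
      rw [Real.dist_eq] at this
      exact this.le
    obtain ⟨L0, h0⟩ := hc zeroSeq
    obtain ⟨L1, h1⟩ := hc oneSeq
    refine ⟨max L0 L1, fun c u hu => ?_⟩
    cases c
    · simpa using h0 u fun i hi => by rw [hu i (by omega), hzero]
    · simpa using h1 u fun i hi => by rw [hu i (by omega), ho]
  set C : ℝ := 2 * ‖f‖ with hC
  have hC0 : 0 ≤ C := by positivity
  have hbig : ∀ u v : BSeq, |f u - f v| ≤ C := by
    intro u v
    rw [← Real.dist_eq]
    exact f.dist_le_two_norm u v
  have hbr2 : Tendsto (fun n => C * (L + 1) *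
      (((b n : ℝ) + 1) / ((∑ i ∈ Finset.range (b n), a i : ℕ) : ℝ))) atTop (𝓝 0) := by
    simpa using hbr.const_mul (C * (L + 1))
  obtain ⟨n0, hn0⟩ := eventually_atTop.1 ((hbr2.eventually
    (gt_mem_nhds (by positivity : (0 : ℝ) < ε / 2))).and (hbt.eventually_ge_atTop 1))
  refine ⟨n0, fun n hn => ?_⟩
  obtain ⟨hsmall, hb_ge⟩ := hn0 n hn
  rw [Real.dist_eq, sub_zero, abs_div, abs_of_pos (by positivity : (0 : ℝ) < (n : ℝ) + 1)]
  -- the bad set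
  classical
  set B : Finset ℕ := ((Finset.range (b n + 1)) ×ˢ (Finset.range (L + 1))).image
    (fun q => (∑ i ∈ Finset.range (q.1 + 1), a i) - q.2) with hB
  have hBcard : (B.card : ℝ) ≤ ((b n : ℝ) + 1) * (L + 1) := by
    have : B.card ≤ (b n + 1) * (L + 1) := by
      refine Finset.card_image_le.trans ?_
      simp
    exact_mod_cast this
  have hpt : ∀ j ∈ Finset.range (n + 1),
      |f (S^[j] z) - f (if z.ap j then oneSeq else zeroSeq)| ≤
        ε / 2 + (if j ∈ B then C else 0) := by
    intro j hj
    rw [Finset.mem_range] at hj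
    by_cases hjB : j ∈ B
    · simp only [hjB, if_true]
      have := hbig (S^[j] z) (if z.ap j then oneSeq else zeroSeq)
      linarith
    · simp only [hjB, if_false, add_zero]
      apply hL
      intro i hi
      rw [hp_iter S hS, hz (b j) j (hb1 j) (hb2 j)]
      apply hz
      · have := hb1 j; omega
      · by_contra hge
        push Not at hge
        apply hjB
        rw [hB, Finset.mem_image]
        have h2 := hb2 j
        refine ⟨(b j, (∑ i ∈ Finset.range (b j + 1), a i) - j), ?_, ?_⟩
        · rw [Finset.mem_product, Finset.mem_range, Finset.mem_range]
          refine ⟨?_, ?_⟩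
          · have := (hp_smono a ha).lt_iff_lt.1
              (lt_of_le_of_lt ((hb1 j).trans (Nat.lt_succ_iff.1 hj)) (hb2 n))
            exact this
          · show (∑ i ∈ Finset.range (b j + 1), a i) - j < L + 1
            omega
        · show (∑ i ∈ Finset.range (b j + 1), a i) - ((∑ i ∈ Finset.range (b j + 1), a i) - j) = j
          omega
  have hsum : |∑ j ∈ Finset.range (n + 1),
      (f (S^[j] z) - f (if z.ap j then oneSeq else zeroSeq))| ≤
      ((n : ℝ) + 1) * (ε / 2) + C * (((b n : ℝ) + 1) * (L + 1)) := by
    refine (Finset.abs_sum_le_sum_abs _ _).trans ((Finset.sum_le_sum hpt).trans ?_)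
    rw [Finset.sum_add_distrib]
    refine add_le_add (by simp) ?_
    rw [← Finset.sum_filter, Finset.sum_const, nsmul_eq_mul, mul_comm]
    refine mul_le_mul_of_nonneg_left ?_ hC0
    refine le_trans ?_ hBcard
    exact_mod_cast Finset.card_le_card (fun j hj => (Finset.mem_filter.1 hj).2)
  have hspos : (0 : ℝ) < ((∑ i ∈ Finset.range (b n), a i : ℕ) : ℝ) := by
    have : b n ≤ ∑ i ∈ Finset.range (b n), a i := (hp_smono a ha).le_apply
    exact_mod_cast (by omega)
  have hsn : ((∑ i ∈ Finset.range (b n), a i : ℕ) : ℝ) ≤ (n : ℝ) + 1 := by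
    have := hb1 n
    exact_mod_cast (by omega)
  calc _ ≤ (((n : ℝ) + 1) * (ε / 2) + C * (((b n : ℝ) + 1) * (L + 1))) / ((n : ℝ) + 1) := by
        gcongr
    _ = ε / 2 + C * (((b n : ℝ) + 1) * (L + 1)) / ((n : ℝ) + 1) := by field_simp
    _ ≤ ε / 2 + C * (((b n : ℝ) + 1) * (L + 1)) /
        ((∑ i ∈ Finset.range (b n), a i : ℕ) : ℝ) := by gcongr
    _ = ε / 2 + C * (L + 1) *
      (((b n : ℝ) + 1) / ((∑ i ∈ Finset.range (b n), a i : ℕ) : ℝ)) := by ring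
    _ < ε := by linarith

lemma hp_emp [MetricSpace BSeq] [MeasurableSpace BSeq] [BorelSpace BSeq]
    (S : BSeq → BSeq) (z : BSeq) (n : ℕ) (f : BoundedContinuousFunction BSeq ℝ) :
    ∫ u, f u ∂((empProb S z n : ProbabilityMeasure BSeq) : Measure BSeq) =
      (∑ j ∈ Finset.range (n + 1), f (S^[j] z)) / ((n : ℝ) + 1) := by
  show ∫ u, f u ∂(empMeas S z (n + 1)) = _
  unfold empMeas
  rw [integral_smul_measure, integral_finset_sum_measure]
  · simp only [integral_dirac]
    rw [ENNReal.toReal_inv, smul_eq_mul, inv_mul_eq_div, ENNReal.toReal_natCast]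
    push_cast
    rfl
  · intro i _
    exact f.integrable _

lemma hp_lin [MetricSpace BSeq] [MeasurableSpace BSeq] [BorelSpace BSeq]
    (u v : BSeq) (α : ℝ≥0∞) (hα : α ≤ 1) (f : BoundedContinuousFunction BSeq ℝ) :
    ∫ w, f w ∂(α • Measure.dirac u + (1 - α) • Measure.dirac v) =
      α.toReal * f u + (1 - α.toReal) * f v := by
  have h1 : α ≠ ∞ := ne_top_of_le_ne_top ENNReal.one_ne_top hα
  have h2 : 1 - α ≠ ∞ := ne_top_of_le_ne_top ENNReal.one_ne_top tsub_le_self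
  rw [integral_add_measure ((f.integrable _).smul_measure h1) ((f.integrable _).smul_measure h2),
    integral_smul_measure, integral_smul_measure, integral_dirac, integral_dirac,
    ENNReal.toReal_sub_of_le hα ENNReal.one_ne_top]
  simp

lemma hp_omega [MetricSpace BSeq] [MeasurableSpace BSeq] [BorelSpace BSeq]
    (hd : ∀ u v : BSeq, u ≠ v →
      dist u v = (2 : ℝ) ^ (-((sInf {i : ℕ | u.ap i ≠ v.ap i} : ℕ) : ℤ)))
    (S : BSeq → BSeq) (hS : ∀ (u : BSeq) (n : ℕ), (S u).ap n = u.ap (n + 1))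
    (a : ℕ → ℕ) (ha : ∀ n, 0 < a n)
    (hlim : Tendsto (fun n => (∑ i ∈ Finset.range n, (a i : ℝ)) / (a n : ℝ)) atTop (𝓝 0))
    (z : BSeq) (p : ℕ → Bool) (hp : ∀ n, p (n + 1) = !p n)
    (hz : ∀ n k : ℕ, (∑ i ∈ Finset.range n, a i) ≤ k → k < ∑ i ∈ Finset.range (n + 1), a i →
      z.ap k = p n)
    (zeroSeq oneSeq : BSeq) (hzero : ∀ i, zeroSeq.ap i = false) (ho : ∀ i, oneSeq.ap i = true) :
    omegaHat S z = {μ : ProbabilityMeasure BSeq | ∃ α : ℝ≥0∞, α ≤ 1 ∧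
      μ.toMeasure = α • MeasureTheory.Measure.dirac zeroSeq +
        (1 - α) • MeasureTheory.Measure.dirac oneSeq} := by
  have key : ∀ (U : Ultrafilter ℕ), (U : Filter ℕ) ≤ atTop → ∀ (α : ℝ≥0∞), α ≤ 1 →
      Tendsto (hpA z) U (𝓝 α.toReal) → ∀ ν : ProbabilityMeasure BSeq,
      ν.toMeasure = α • MeasureTheory.Measure.dirac zeroSeq +
        (1 - α) • MeasureTheory.Measure.dirac oneSeq → Tendsto (empProb S z) U (𝓝 ν) := by
    intro U hU α hα hA ν hν
    rw [ProbabilityMeasure.tendsto_iff_forall_integral_tendsto]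
    intro f
    have h1 := (hp_avg hd S hS a ha hlim z p hz zeroSeq oneSeq hzero ho f).mono_left hU
    have h2 := h1.add ((hA.mul_const (f zeroSeq)).add
      ((tendsto_const_nhds.sub hA : Tendsto (fun n => 1 - hpA z n) U _).mul_const (f oneSeq)))
    have e : ∫ u, f u ∂(ν : Measure BSeq) = α.toReal * f zeroSeq + (1 - α.toReal) * f oneSeq := by
      rw [← hp_lin zeroSeq oneSeq α hα f, ← hν]
    rw [e]
    simp only [hp_emp]
    simpa using h2
  ext μ
  simp only [omegaHat, Set.mem_setOf_eq]
  constructor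
  · intro h
    obtain ⟨U, hU, hμ⟩ := mapClusterPt_iff_ultrafilter.1 h
    have hmem : ∀ n, hpA z n ∈ Set.Icc (0 : ℝ) 1 := fun n => ⟨hpA_nonneg z n, hpA_le_one z n⟩
    obtain ⟨r, hr, hrU⟩ := (isCompact_Icc (a := (0 : ℝ)) (b := 1)).ultrafilter_le_nhds
      (U.map (hpA z)) (by
        rw [le_principal_iff]
        exact Eventually.of_forall (f := (U : Filter ℕ)) hmem)
    have hα : ENNReal.ofReal r ≤ 1 := by
      rw [ENNReal.ofReal_le_one]; exact hr.2
    refine ⟨ENNReal.ofReal r, hα, ?_⟩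
    have hprob : IsProbabilityMeasure (ENNReal.ofReal r • Measure.dirac zeroSeq +
        (1 - ENNReal.ofReal r) • Measure.dirac oneSeq) := by
      constructor
      simp [hα]
    have ht := key U hU (ENNReal.ofReal r) hα (by rw [ENNReal.toReal_ofReal hr.1]; exact hrU)
      ⟨_, hprob⟩ rfl
    have := tendsto_nhds_unique hμ ht
    rw [this]
    rfl
  · rintro ⟨α, hα, hμ⟩
    have hc := hpA_cluster a ha hlim z p hp hz α.toReal ENNReal.toReal_nonneg
      (ENNReal.toReal_mono ENNReal.one_ne_top hα)
    obtain ⟨U, hU, hA⟩ := mapClusterPt_iff_ultrafilter.1 hc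
    exact mapClusterPt_iff_ultrafilter.2 ⟨U, hU, key U hU α hα hA μ hμ⟩

end Helpers

/-- for the full shift `({0,1}^ℕ, S)` with the standard metric and the points
`x = 0^{a_1}1^{a_2}0^{a_3}1^{a_4}…`, `y = 1^{a_1}0^{a_2}1^{a_3}0^{a_4}…`, where the positive
integers `a_n` satisfy `(a_1+…+a_n)/a_{n+1} → 0`, one has `Ē(x,y) = 1`, while
`ω̂_S(x) = ω̂_S(y) = {α δ_{0̄} + (1−α) δ_{1̄} : α ∈ [0,1]}`. -/
theorem shift_example_Ebar_one_same_omegaHat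
    [MetricSpace BSeq] [MeasurableSpace BSeq] [BorelSpace BSeq]
    (hd : ∀ u v : BSeq, u ≠ v →
      dist u v = (2 : ℝ) ^ (-((sInf {i : ℕ | u.ap i ≠ v.ap i} : ℕ) : ℤ)))
    (S : BSeq → BSeq) (hS : ∀ (u : BSeq) (n : ℕ), (S u).ap n = u.ap (n + 1))
    (a : ℕ → ℕ) (ha : ∀ n, 0 < a n)
    (hlim : Tendsto (fun n => (∑ i ∈ Finset.range n, (a i : ℝ)) / (a n : ℝ)) atTop (𝓝 0))
    (x y : BSeq)
    (hx : ∀ n k : ℕ, (∑ i ∈ Finset.range n, a i) ≤ k → k < ∑ i ∈ Finset.range (n + 1), a i →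
      x.ap k = (n % 2 == 1))
    (hy : ∀ n k : ℕ, (∑ i ∈ Finset.range n, a i) ≤ k → k < ∑ i ∈ Finset.range (n + 1), a i →
      y.ap k = (n % 2 == 0))
    (zeroSeq oneSeq : BSeq) (hz : ∀ i, zeroSeq.ap i = false) (ho : ∀ i, oneSeq.ap i = true) :
    Ebar S x y = 1 ∧
    omegaHat S x = {μ : ProbabilityMeasure BSeq | ∃ α : ℝ≥0∞, α ≤ 1 ∧
      μ.toMeasure = α • MeasureTheory.Measure.dirac zeroSeq +
        (1 - α) • MeasureTheory.Measure.dirac oneSeq} ∧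
    omegaHat S y = {μ : ProbabilityMeasure BSeq | ∃ α : ℝ≥0∞, α ≤ 1 ∧
      μ.toMeasure = α • MeasureTheory.Measure.dirac zeroSeq +
        (1 - α) • MeasureTheory.Measure.dirac oneSeq} := by
  refine ⟨hp_Ebar hd S hS a ha hlim x y hx hy,
    hp_omega hd S hS a ha hlim x (fun n => n % 2 == 1) ?_ hx zeroSeq oneSeq hz ho,
    hp_omega hd S hS a ha hlim y (fun n => n % 2 == 0) ?_ hy zeroSeq oneSeq hz ho⟩
  · intro n
    rcases Nat.mod_two_eq_zero_or_one n with h | h <;> simp [Nat.add_mod, h]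
  · intro n
    rcases Nat.mod_two_eq_zero_or_one n with h | h <;> simp [Nat.add_mod, h]
end

section
/- If (X,T) is Ē-continuous (for every ε>0 there is δ>0 with d(x,y)<δ ⟹ Ē(x,y)<ε) and has a dense orbit, then (X,T) is uniquely ergodic. -/
open Filter MeasureTheory Topology
open scoped ENNReal NNReal

lemma birk_eq {X : Type*} (T : X → X) (f : X → ℝ) (n : ℕ) (x : X) :
    birkhoffAverage ℝ T f n x = (1 / (n : ℝ)) * ∑ k : Fin n, f (T^[(k : ℕ)] x) := by
  rw [birkhoffAverage, birkhoffSum, smul_eq_mul, one_div, Finset.sum_range]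

lemma birk_bound {X : Type*} (T : X → X) (f : X → ℝ) (M : ℝ) (hM : 0 ≤ M) (hf : ∀ x, |f x| ≤ M)
    (n : ℕ) (x : X) : |birkhoffAverage ℝ T f n x| ≤ M := by
  rw [birk_eq, abs_mul]
  rcases Nat.eq_zero_or_pos n with rfl | hn
  · simpa using hM
  have hn' : (0 : ℝ) < n := by exact_mod_cast hn
  have h1 : |∑ k : Fin n, f (T^[(k : ℕ)] x)| ≤ n * M := by
    refine (Finset.abs_sum_le_sum_abs _ _).trans ?_
    refine (Finset.sum_le_sum (fun i _ => hf _)).trans ?_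
    simp
  rw [abs_of_pos (by positivity)]
  calc 1 / (n : ℝ) * _ ≤ 1 / (n : ℝ) * (n * M) := by gcongr
    _ = M := by field_simp

lemma birk_diff {X : Type*} [MetricSpace X] (T : X → X) (f : X → ℝ) (e C : ℝ) (he : 0 ≤ e)
    (hf : ∀ a b, |f a - f b| ≤ e + C * dist a b) (n : ℕ) (x y : X) :
    |birkhoffAverage ℝ T f n x - birkhoffAverage ℝ T f n y| ≤ e + C * EnDist T n x y := by
  obtain ⟨σ, hσ⟩ := exists_eq_ciInf_of_finite
    (f := fun σ : Equiv.Perm (Fin n) =>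
      (1 / (n : ℝ)) * ∑ k : Fin n, dist (T^[(k : ℕ)] x) (T^[((σ k) : ℕ)] y))
  have hσ' : EnDist T n x y =
    (1 / (n : ℝ)) * ∑ k : Fin n, dist (T^[(k : ℕ)] x) (T^[((σ k) : ℕ)] y) := hσ.symm
  rw [hσ', birk_eq, birk_eq]
  rcases Nat.eq_zero_or_pos n with rfl | hn
  · simpa using he
  have hn' : (0 : ℝ) < n := by exact_mod_cast hn
  rw [← Equiv.sum_comp σ (fun k : Fin n => f (T^[(k : ℕ)] y)), ← mul_sub,
    ← Finset.sum_sub_distrib, abs_mul, abs_of_pos (by positivity)]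
  calc 1 / (n : ℝ) * |∑ k : Fin n, (f (T^[(k : ℕ)] x) - f (T^[((σ k) : ℕ)] y))|
      ≤ 1 / (n : ℝ) * ∑ k : Fin n, (e + C * dist (T^[(k : ℕ)] x) (T^[((σ k) : ℕ)] y)) := by
        gcongr
        exact (Finset.abs_sum_le_sum_abs _ _).trans (Finset.sum_le_sum fun i _ => hf _ _)
    _ = _ := by
        rw [Finset.sum_add_distrib, ← Finset.mul_sum]
        simp
        field_simp

lemma EnDist_bdd {X : Type*} [MetricSpace X] [CompactSpace X] (T : X → X) (x y : X) :
    IsBoundedUnder (· ≤ ·) atTop (fun n => EnDist T n x y) := by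
  refine isBoundedUnder_of ⟨Metric.diam (Set.univ : Set X), fun n => ?_⟩
  unfold EnDist
  refine (ciInf_le (Set.finite_range _).bddBelow (Equiv.refl _)).trans ?_
  have h1 : ∑ k : Fin n, dist (T^[(k : ℕ)] x) (T^[((Equiv.refl (Fin n) k) : ℕ)] y)
      ≤ n * Metric.diam (Set.univ : Set X) := by
    refine (Finset.sum_le_sum (fun i _ => Metric.dist_le_diam_of_mem
      isCompact_univ.isBounded (Set.mem_univ _) (Set.mem_univ _))).trans ?_
    simp
  rcases Nat.eq_zero_or_pos n with rfl | hn
  · simpa using Metric.diam_nonneg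
  have hn' : (0 : ℝ) < n := by exact_mod_cast hn
  calc 1 / (n : ℝ) * _ ≤ 1 / (n : ℝ) * (n * Metric.diam (Set.univ : Set X)) := by gcongr
    _ = _ := by field_simp

lemma cont_modulus {X : Type*} [MetricSpace X] [CompactSpace X] (f : X → ℝ) (hf : Continuous f)
    (M : ℝ) (hM : 0 ≤ M) (hfM : ∀ x, |f x| ≤ M) (e : ℝ) (he : 0 < e) :
    ∃ C > 0, ∀ a b, |f a - f b| ≤ e + C * dist a b := by
  obtain ⟨δ, hδ, h⟩ := Metric.uniformContinuous_iff.1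
    (CompactSpace.uniformContinuous_of_continuous hf) e he
  refine ⟨(2 * M + 1) / δ, by positivity, fun a b => ?_⟩
  by_cases hab : dist a b < δ
  · have := h hab
    rw [Real.dist_eq] at this
    have : 0 ≤ (2 * M + 1) / δ * dist a b := by positivity
    linarith
  · push Not at hab
    have h1 : 2 * M + 1 ≤ (2 * M + 1) / δ * dist a b := by
      rw [div_mul_eq_mul_div, le_div_iff₀ hδ]
      gcongr
    have := abs_sub (f a) (f b)
    have := hfM a
    have := hfM b
    linarith

lemma tendsto_iterate {X : Type*} (T : X → X) (f : X → ℝ) (M : ℝ)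
    (hfM : ∀ x, |f x| ≤ M) (x : X) (m : ℕ) :
    Tendsto (fun n => birkhoffAverage ℝ T f n (T^[m] x) - birkhoffAverage ℝ T f n x)
      atTop (𝓝 0) := by
  have hb : Bornology.IsBounded (Set.range f) := by
    refine (Metric.isBounded_iff_subset_closedBall 0).2 ⟨M, ?_⟩
    rintro _ ⟨z, rfl⟩
    simpa using hfM z
  induction m with
  | zero => simp
  | succ m ih =>
    have := (tendsto_birkhoffAverage_apply_sub_birkhoffAverage' (𝕜 := ℝ) (f := T) hb
      (T^[m] x)).add ih
    simpa [Function.iterate_succ_apply'] using this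

lemma tendsto_birk {X : Type*} [MetricSpace X] [CompactSpace X] (T : X → X)
    (hcont : ∀ ε > (0 : ℝ), ∃ δ > (0 : ℝ), ∀ x y : X, dist x y < δ → Ebar T x y < ε)
    (x : X) (hx : Dense (Set.range fun n : ℕ => T^[n] x))
    (f : X → ℝ) (hf : Continuous f)
    (M : ℝ) (hM : 0 ≤ M) (hfM : ∀ x, |f x| ≤ M) (y : X) :
    Tendsto (fun n => birkhoffAverage ℝ T f n y - birkhoffAverage ℝ T f n x) atTop (𝓝 0) := by
  rw [Metric.tendsto_nhds]
  intro ε hε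
  obtain ⟨C, hC, hmod⟩ := cont_modulus f hf M hM hfM (ε / 3) (by positivity)
  obtain ⟨δ, hδ, h⟩ := hcont (ε / (3 * C)) (by positivity)
  obtain ⟨_, ⟨m, rfl⟩, hm⟩ := hx.exists_dist_lt y hδ
  have h2 := eventually_lt_of_limsup_lt (h _ _ hm) (EnDist_bdd T _ _)
  have h3 := (Metric.tendsto_nhds.1 (tendsto_iterate T f M hfM x m)) (ε / 3) (by positivity)
  filter_upwards [h2, h3] with n hn2 hn3
  rw [Real.dist_eq, sub_zero] at hn3 ⊢
  have h4 := birk_diff T f (ε / 3) C (by positivity) hmod n y (T^[m] x)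
  have h5 : C * EnDist T n y (T^[m] x) < ε / 3 := by
    calc _ < C * (ε / (3 * C)) := by gcongr
      _ = ε / 3 := by field_simp
  have h6 := abs_sub_le (birkhoffAverage ℝ T f n y) (birkhoffAverage ℝ T f n (T^[m] x))
    (birkhoffAverage ℝ T f n x)
  linarith

lemma continuous_birk {X : Type*} [TopologicalSpace X] (T : X → X) (hT : Continuous T)
    (f : X → ℝ) (hf : Continuous f) (n : ℕ) : Continuous (birkhoffAverage ℝ T f n) := by
  have : birkhoffAverage ℝ T f n = fun x => (1 / (n : ℝ)) * ∑ k : Fin n, f (T^[(k : ℕ)] x) :=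
    funext fun x => birk_eq T f n x
  rw [this]
  have := fun k : ℕ => hT.iterate k
  fun_prop

lemma integral_birk {X : Type*} [MetricSpace X] [CompactSpace X] [MeasurableSpace X]
    [BorelSpace X] (T : X → X) (hT : Continuous T) (f : X → ℝ) (hf : Continuous f)
    (μ : Measure X) [IsProbabilityMeasure μ] (hμ : Measure.map T μ = μ) (n : ℕ) (hn : 0 < n) :
    ∫ x, birkhoffAverage ℝ T f n x ∂μ = ∫ x, f x ∂μ := by
  have hmp : MeasurePreserving T μ μ := ⟨hT.measurable, hμ⟩
  have hk : ∀ k : ℕ, ∫ x, f (T^[k] x) ∂μ = ∫ x, f x ∂μ := by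
    intro k
    have h := (hmp.iterate k)
    rw [← integral_map (φ := T^[k]) (f := f) h.measurable.aemeasurable
      hf.measurable.aestronglyMeasurable, h.map_eq]
  simp_rw [birk_eq]
  rw [integral_const_mul, integral_finsetSum]
  · simp only [hk]
    simp
    field_simp
  · intro i _
    exact (hf.comp (hT.iterate i)).integrable_of_hasCompactSupport
      (HasCompactSupport.of_compactSpace _)

lemma tendsto_integral {X : Type*} [MetricSpace X] [CompactSpace X] [MeasurableSpace X]
    [BorelSpace X] (T : X → X) (hT : Continuous T)
    (hcont : ∀ ε > (0 : ℝ), ∃ δ > (0 : ℝ), ∀ x y : X, dist x y < δ → Ebar T x y < ε)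
    (x : X) (hx : Dense (Set.range fun n : ℕ => T^[n] x))
    (f : X → ℝ) (hf : Continuous f)
    (M : ℝ) (hM : 0 ≤ M) (hfM : ∀ x, |f x| ≤ M)
    (μ : Measure X) [IsProbabilityMeasure μ] (hμ : Measure.map T μ = μ) :
    Tendsto (fun n => birkhoffAverage ℝ T f n x) atTop (𝓝 (∫ y, f y ∂μ)) := by
  have h := tendsto_integral_of_dominated_convergence (μ := μ)
    (F := fun n y => birkhoffAverage ℝ T f n y - birkhoffAverage ℝ T f n x)
    (f := fun _ => 0) (fun _ => M + M)
    (fun n => ((continuous_birk T hT f hf n).sub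
      continuous_const).measurable.aestronglyMeasurable)
    (integrable_const _)
    (fun n => Eventually.of_forall fun y => (abs_sub _ _).trans
      (add_le_add (birk_bound T f M hM hfM n y) (birk_bound T f M hM hfM n x)))
    (Eventually.of_forall fun y => tendsto_birk T hcont x hx f hf M hM hfM y)
  rw [integral_zero] at h
  have h' := (tendsto_const_nhds (x := ∫ y, f y ∂μ)).sub h
  rw [sub_zero] at h'
  refine h'.congr' ?_
  filter_upwards [eventually_gt_atTop 0] with n hn
  rw [integral_sub ((continuous_birk T hT f hf n).integrable_of_hasCompactSupport
      (HasCompactSupport.of_compactSpace _)) (integrable_const _),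
    integral_birk T hT f hf μ hμ n hn]
  simp

lemma exists_invariant {X : Type*} [MetricSpace X] [CompactSpace X] [MeasurableSpace X]
    [BorelSpace X] (T : X → X) (hT : Continuous T) (x : X) :
    ∃ μ : Measure X, IsProbabilityMeasure μ ∧ Measure.map T μ = μ := by
  let ν0 : ℕ → Measure X := fun n =>
    ((n + 1 : ℕ) : ℝ≥0∞)⁻¹ • ∑ k ∈ Finset.range (n + 1), Measure.dirac (T^[k] x)
  have hν0 : ∀ n, IsProbabilityMeasure (ν0 n) := by
    intro n
    constructor
    simp only [ν0, Measure.smul_apply, Measure.finsetSum_apply, smul_eq_mul]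
    simp only [measure_univ, Finset.sum_const, Finset.card_range, nsmul_eq_mul, mul_one]
    exact ENNReal.inv_mul_cancel (by simp) (by finiteness)
  let ν : ℕ → ProbabilityMeasure X := fun n => ⟨ν0 n, hν0 n⟩
  have hint : ∀ (g : X → ℝ), Continuous g → ∀ n,
      ∫ y, g y ∂(ν n : Measure X) = birkhoffAverage ℝ T g (n + 1) x := by
    intro g hg n
    change ∫ y, g y ∂(ν0 n) = _
    simp only [ν0]
    rw [integral_smul_measure, integral_finsetSum_measure]
    · simp only [integral_dirac, birkhoffAverage, birkhoffSum]
      congr 1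
      rw [ENNReal.toReal_inv, ENNReal.toReal_natCast]
    · intro i _
      exact hg.integrable_of_hasCompactSupport (HasCompactSupport.of_compactSpace _)
  let U := Ultrafilter.map ν (hyperfilter ℕ)
  obtain ⟨μ, -, hμ⟩ := isCompact_univ.ultrafilter_le_nhds U (by simp)
  have hμ' : Tendsto ν (hyperfilter ℕ) (𝓝 μ) := hμ
  rw [ProbabilityMeasure.tendsto_iff_forall_integral_tendsto] at hμ'
  refine ⟨μ, inferInstance, ?_⟩
  have : IsProbabilityMeasure (Measure.map T (μ : Measure X)) :=
    Measure.isProbabilityMeasure_map hT.aemeasurable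
  refine ext_of_forall_integral_eq_of_IsFiniteMeasure fun f => ?_
  rw [integral_map hT.aemeasurable f.continuous.measurable.aestronglyMeasurable]
  have h1 := hμ' f
  have h2 := hμ' (f.compContinuous ⟨T, hT⟩)
  have h3 := (tendsto_iterate T f ‖f‖ (fun z => f.norm_coe_le_norm z) x 1).comp
    (tendsto_add_atTop_nat 1)
  have h4 := h3.mono_left (Nat.hyperfilter_le_atTop)
  have h5 := h2.sub h1
  refine sub_eq_zero.1 (tendsto_nhds_unique h5 (h4.congr fun n => ?_))
  rw [hint _ (f.compContinuous ⟨T, hT⟩).continuous, hint _ f.continuous]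
  simp only [Function.comp_apply, birkhoffAverage, birkhoffSum]
  congr 3
  ext k
  simp [← Function.iterate_succ_apply' , Function.iterate_succ_apply]

/-- if `(X,T)` is `Ē`-continuous and has a dense orbit, then it is uniquely
ergodic. -/
theorem uniquelyErgodic_of_EbarContinuous_denseOrbit {X : Type*} [MetricSpace X]
    [CompactSpace X] [MeasurableSpace X] [BorelSpace X] (T : X → X) (hT : Continuous T)
    (hcont : ∀ ε > (0 : ℝ), ∃ δ > (0 : ℝ), ∀ x y : X, dist x y < δ → Ebar T x y < ε)
    (hdense : ∃ x : X, Dense (Set.range fun n : ℕ => T^[n] x)) :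
    ∃! μ : Measure X, IsProbabilityMeasure μ ∧ Measure.map T μ = μ := by
  obtain ⟨x, hx⟩ := hdense
  obtain ⟨μ, hμ, hTμ⟩ := exists_invariant T hT x
  refine ⟨μ, ⟨hμ, hTμ⟩, ?_⟩
  rintro μ' ⟨hμ', hTμ'⟩
  refine ext_of_forall_integral_eq_of_IsFiniteMeasure fun f => ?_
  exact tendsto_nhds_unique
    (tendsto_integral T hT hcont x hx f f.continuous ‖f‖ (norm_nonneg _)
      (fun z => f.norm_coe_le_norm z) μ' hTμ')
    (tendsto_integral T hT hcont x hx f f.continuous ‖f‖ (norm_nonneg _)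
      (fun z => f.norm_coe_le_norm z) μ hTμ)
end
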